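/- arXiv:1404.4583 — 5 statements merged into one kernel-verified Lean document; each statement's English description precedes it below -/
import Mathlib

section
/- For every integer n ≥ 2, all nonnegative reals m_1, …, m_n and every s > 0, the Mellin transform of the product weight function is a product of Gamma functions: ∫_0^∞ R^{s−1} Ω_n(R) dR = π^{n−1} ∏_{j=1}^n Γ(m_j + s), where Ω_n(R) = (2π)^{n−1} R^{m_n} ∫_{(0,∞)^{n−1}} ∏_{i=1}^{n−1} r_i^{2(m_i − m_n) − 1} exp( − Σ_{j=1}^{n−1} r_j² − R/(r_1² ⋯ r_{n−1}²) ) dr_1 ⋯ dr_{n−1}. -/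
open MeasureTheory Real

/-- The Gaussian moment `∫_0^∞ x^{2a-1} e^{-x²} dx = Γ(a)/2`. -/
theorem integral_rpow_mul_exp_neg_sq_Ioi {a : ℝ} (ha : 0 < a) :
    ∫ x in Set.Ioi (0 : ℝ), x ^ (2 * a - 1) * Real.exp (-x ^ 2) = Real.Gamma a / 2 := by
  have h := integral_rpow_mul_exp_neg_rpow (p := 2) (q := 2 * a - 1) two_pos (by linarith)
  simp only [rpow_two] at h
  rw [h, show (2 * a - 1 + 1) / 2 = a by ring]
  ring

theorem integrableOn_rpow_mul_exp_neg_sq_Ioi {a : ℝ} (ha : 0 < a) :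
    IntegrableOn (fun x : ℝ => x ^ (2 * a - 1) * Real.exp (-x ^ 2)) (Set.Ioi 0) := by
  have h := integrableOn_rpow_mul_exp_neg_rpow (p := 2) (s := 2 * a - 1) (by linarith) two_pos
  simpa only [rpow_two] using h

/-- Integrability of the Gamma integrand `t^{a-1} e^{-rt}`. -/
theorem integrableOn_rpow_mul_exp_neg_mul_Ioi {a r : ℝ} (ha : 0 < a) (hr : 0 < r) :
    IntegrableOn (fun t : ℝ => t ^ (a - 1) * Real.exp (-(r * t))) (Set.Ioi 0) := by
  have h := integrableOn_rpow_mul_exp_neg_mul_rpow (p := 1) (s := a - 1) (b := r)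
    (by linarith) one_pos hr
  simpa only [rpow_one, neg_mul] using h

/-- Mellin transform of an iterated multiplicative convolution of Gamma densities, for an
arbitrary finite index type. -/
theorem mellin_integral_gamma_convolution {ι : Type*} [Fintype ι] (a : ι → ℝ) (c s : ℝ)
    (ha : ∀ i, 0 < a i + s) (hc : 0 < c + s) :
    (∫ R in Set.Ioi (0 : ℝ), ∫ r : ι → ℝ in Set.univ.pi fun _ => Set.Ioi (0 : ℝ),
      R ^ (c + s - 1) * ((∏ i, r i ^ (2 * (a i - c) - 1)) *
        Real.exp (-(∑ j, (r j) ^ 2) - R / ∏ j, (r j) ^ 2))) =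
      Real.Gamma (c + s) * ∏ i, (Real.Gamma (a i + s) / 2) := by
  set ν : Measure (ι → ℝ) := volume.restrict (Set.univ.pi fun _ => Set.Ioi (0 : ℝ)) with hν
  have hνpi : ν = Measure.pi fun _ => volume.restrict (Set.Ioi (0 : ℝ)) := by
    rw [hν, volume_pi, Measure.restrict_pi_pi]
  have hpos : ∀ᵐ r ∂ν, ∀ i, 0 < r i := by
    filter_upwards [ae_restrict_mem (MeasurableSet.univ_pi fun _ => measurableSet_Ioi)]
      with r hr i using hr i trivial
  set F : ℝ → (ι → ℝ) → ℝ := fun R r =>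
    R ^ (c + s - 1) * ((∏ i, r i ^ (2 * (a i - c) - 1)) *
      Real.exp (-(∑ j, (r j) ^ 2) - R / ∏ j, (r j) ^ 2)) with hF
  set g : (ι → ℝ) → ℝ := fun r => ∏ i, (r i ^ (2 * (a i + s) - 1) * Real.exp (-(r i) ^ 2)) with hg
  have hFeq (r : ι → ℝ) (R : ℝ) : F R r =
      ((∏ i, r i ^ (2 * (a i - c) - 1)) * Real.exp (-(∑ j, (r j) ^ 2))) *
        (R ^ (c + s - 1) * Real.exp (-((∏ j, (r j) ^ 2)⁻¹ * R))) := by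
    simp only [hF]
    rw [sub_eq_add_neg (-(∑ j, (r j) ^ 2)), Real.exp_add, div_eq_inv_mul]
    ring
  have hFint (r : ι → ℝ) (hr : ∀ i, 0 < r i) :
      ∫ R in Set.Ioi (0 : ℝ), F R r = Real.Gamma (c + s) * g r := by
    have hP : 0 < (∏ j, (r j) ^ 2)⁻¹ := inv_pos.2 (Finset.prod_pos fun j _ => pow_pos (hr j) 2)
    simp only [hFeq]
    rw [integral_const_mul, Real.integral_rpow_mul_exp_neg_mul_Ioi hc hP, one_div, inv_inv,
      ← Real.finsetProd_rpow _ _ (fun i _ => (pow_pos (hr i) 2).le), hg,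
      ← Finset.sum_neg_distrib, Real.exp_sum, ← Finset.prod_mul_distrib,
      ← mul_assoc, mul_comm _ (Real.Gamma _), ← Finset.prod_mul_distrib]
    congr 1
    refine Finset.prod_congr rfl fun i _ => ?_
    rw [← Real.rpow_natCast (r i) 2, ← Real.rpow_mul (hr i).le, mul_right_comm,
      ← Real.rpow_add (hr i)]
    congr 2
    push_cast
    ring
  have hgint : Integrable g ν := by
    rw [hνpi]
    exact Integrable.fintype_prod fun i => integrableOn_rpow_mul_exp_neg_sq_Ioi (ha i)
  have hFnonneg : ∀ᵐ r ∂ν, ∫ R in Set.Ioi (0 : ℝ), ‖F R r‖ = Real.Gamma (c + s) * g r := by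
    filter_upwards [hpos] with r hr
    rw [← hFint r hr]
    refine setIntegral_congr_fun measurableSet_Ioi fun R hR => ?_
    refine Real.norm_of_nonneg (mul_nonneg (rpow_nonneg (le_of_lt hR) _) (mul_nonneg ?_ ?_))
    · exact Finset.prod_nonneg fun i _ => rpow_nonneg (hr i).le _
    · positivity
  have hmeas : Measurable (Function.uncurry F) := by
    simp only [hF, Function.uncurry_def]
    fun_prop
  have hint : Integrable (Function.uncurry F) ((volume.restrict (Set.Ioi (0 : ℝ))).prod ν) := by
    refine (integrable_prod_iff' hmeas.aestronglyMeasurable).2 ⟨?_, ?_⟩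
    · filter_upwards [hpos] with r hr
      simp only [Function.uncurry_apply_pair, hFeq]
      exact (integrableOn_rpow_mul_exp_neg_mul_Ioi hc
        (inv_pos.2 (Finset.prod_pos fun j _ => pow_pos (hr j) 2))).const_mul _
    · exact (hgint.const_mul _).congr (hFnonneg.mono fun r hr => hr.symm)
  rw [integral_integral_swap hint, integral_congr_ae (hpos.mono hFint), integral_const_mul, hνpi,
    hg, integral_fintype_prod_eq_prod
      (fun i (x : ℝ) => x ^ (2 * (a i + s) - 1) * Real.exp (-x ^ 2))]
  simp only [integral_rpow_mul_exp_neg_sq_Ioi (ha _)]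



theorem prod_Icc_one_eq_prod_fin {M : Type*} [CommMonoid M] (f : ℕ → M) (n : ℕ) :
    ∏ j ∈ Finset.Icc 1 n, f j = ∏ i : Fin n, f ((i : ℕ) + 1) := by
  induction n with
  | zero => simp
  | succ n ih =>
    rw [Finset.prod_Icc_succ_top (by omega), ih, Fin.prod_univ_castSucc]
    simp only [Fin.val_castSucc, Fin.val_last]

/-- The Mellin transform of the radial weight function of the product of `n` induced
complex Ginibre matrices is a product of Gamma functions:
`∫_0^∞ R^{s-1} Ω_n(R) dR = π^{n-1} ∏_{j=1}^n Γ(m_j + s)`. -/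
theorem mellin_transform_of_product_weight
    (n : ℕ) (hn : 2 ≤ n) (m : ℕ → ℝ) (hm : ∀ j, 0 ≤ m j)
    (s : ℝ) (hs : 0 < s)
    (Ω : ℝ → ℝ)
    (hΩ : ∀ R : ℝ, Ω R = (2 * π) ^ (n - 1) * R ^ (m n) *
      ∫ r : Fin (n - 1) → ℝ in Set.univ.pi fun _ => Set.Ioi (0 : ℝ),
        (∏ i : Fin (n - 1), r i ^ (2 * (m ((i : ℕ) + 1) - m n) - 1)) *
          Real.exp (-(∑ j : Fin (n - 1), (r j) ^ 2)
            - R / ∏ j : Fin (n - 1), (r j) ^ 2)) :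
    (∫ R in Set.Ioi (0 : ℝ), R ^ (s - 1) * Ω R)
      = π ^ (n - 1) * ∏ j ∈ Finset.Icc 1 n, Real.Gamma (m j + s) := by
  obtain ⟨k, rfl⟩ : ∃ k, n = k + 1 := ⟨n - 1, by omega⟩
  change ∀ R : ℝ, Ω R = (2 * π) ^ k * R ^ (m (k + 1)) *
      ∫ r : Fin k → ℝ in Set.univ.pi fun _ => Set.Ioi (0 : ℝ),
        (∏ i : Fin k, r i ^ (2 * (m ((i : ℕ) + 1) - m (k + 1)) - 1)) *
          Real.exp (-(∑ j : Fin k, (r j) ^ 2) - R / ∏ j : Fin k, (r j) ^ 2) at hΩ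
  rw [Nat.add_sub_cancel]
  have hpos (j : ℕ) : 0 < m j + s := add_pos_of_nonneg_of_pos (hm j) hs
  have key := mellin_integral_gamma_convolution (fun i : Fin k => m ((i : ℕ) + 1)) (m (k + 1)) s
    (fun i => hpos _) (hpos _)
  have hprod : ∏ j ∈ Finset.Icc 1 (k + 1), Real.Gamma (m j + s) =
      (∏ i : Fin k, Real.Gamma (m ((i : ℕ) + 1) + s)) * Real.Gamma (m (k + 1) + s) := by
    rw [prod_Icc_one_eq_prod_fin, Fin.prod_univ_castSucc]
    simp only [Fin.val_castSucc, Fin.val_last]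
  calc ∫ R in Set.Ioi (0 : ℝ), R ^ (s - 1) * Ω R
      = (2 * π) ^ k * (Real.Gamma (m (k + 1) + s) *
          ∏ i : Fin k, (Real.Gamma (m ((i : ℕ) + 1) + s) / 2)) := by
        rw [← key, ← integral_const_mul]
        refine setIntegral_congr_fun measurableSet_Ioi fun R hR => ?_
        have hexp : R ^ (m (k + 1) + s - 1) = R ^ (s - 1) * R ^ (m (k + 1)) := by
          rw [← Real.rpow_add hR]
          congr 1
          ring
        simp only [hΩ, integral_const_mul, hexp]
        ring
    _ = π ^ k * ∏ j ∈ Finset.Icc 1 (k + 1), Real.Gamma (m j + s) := by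
        rw [hprod, Finset.prod_div_distrib, Finset.prod_const, Finset.card_univ, Fintype.card_fin,
          mul_pow]
        field_simp
end

section
/- Fix an integer N ≥ 1. There exist constants C > 0 and R₀ > 0 such that for all r ≥ R₀, | (∏_{k=1}^N p_k(r)) · [ (2π)^{N(n−1)/2} / ( n^{N/2} ∏_{k=1}^N ∏_{a=1}^n Γ(k+m_a) ) · exp( −nN r^{2/n} + N( N + (2(m_1+⋯+m_n) − 1)/n ) log r ) ]^{−1} − 1 | ≤ C r^{−2/n}. That is, the hole probability of the generalised induced finite-N complex Ginibre ensemble satisfies ∏_{k=1}^N p_k(r) = (2π)^{N(n−1)/2} n^{−N/2} (∏_{k=1}^N ∏_{a=1}^n Γ(k+m_a))^{−1} exp{ −nN r^{2/n} + N(N + (2(m_1+⋯+m_n)−1)/n) log r } (1 + O(r^{−2/n})) as r → ∞. -/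
open MeasureTheory Real

/-- The phase function of the one-dimensional Laplace integrals, in logarithmic coordinates. -/
noncomputable def laplacePhase (ν x : ℝ) : ℝ := exp x + ν * exp (-(x / ν)) - (ν + 1)

lemma abs_exp_sub_cubic_le (x : ℝ) :
    |exp x - (1 + x + x ^ 2 / 2 + x ^ 3 / 6)| ≤ x ^ 4 * exp |x| := by
  have h := Complex.norm_exp_sub_sum_le_norm_mul_exp (x : ℂ) 4
  simp only [Finset.sum_range_succ, Finset.sum_range_zero, Nat.factorial, Complex.norm_real] at h
  rw [norm_eq_abs, Even.pow_abs (by decide)] at h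
  rw [← norm_eq_abs, ← Complex.norm_real]
  convert! h using 2
  push_cast
  ring

lemma abs_exp_sub_one_sub_le (x : ℝ) : |exp x - 1 - x| ≤ x ^ 2 * (1 + exp x) := by
  have h0 := add_one_le_exp x
  rw [abs_of_nonneg (by linarith)]
  have h1 := add_one_le_exp (-x)
  have h2 : exp (-x) * exp x = 1 := by rw [← exp_add]; simp
  have hpos := exp_pos x
  rcases le_total 0 x with hx | hx
  · have : exp x * (1 - x) ≤ 1 := by nlinarith
    nlinarith [mul_nonneg hx (sub_nonneg.2 this)]
  · have : exp x * (1 - x) ≤ 1 := by nlinarith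
    nlinarith [mul_nonneg (neg_nonneg.2 hx) (sub_nonneg.2 h0), sq_nonneg x,
      mul_nonneg (neg_nonneg.2 hx) (sub_nonneg.2 this), mul_nonneg (sq_nonneg x) hpos.le]

lemma sq_div_two_le_exp_sub {x : ℝ} (hx : 0 ≤ x) : x ^ 2 / 2 ≤ exp x - 1 - x := by
  have := quadratic_le_exp_of_nonneg hx
  linarith

lemma sq_div_le_laplacePhase {ν : ℝ} (hν : 1 ≤ ν) (x : ℝ) :
    x ^ 2 / (2 * ν) ≤ laplacePhase ν x := by
  have hν0 : 0 < ν := by linarith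
  have hsplit : laplacePhase ν x =
      (exp x - 1 - x) + ν * (exp (-(x / ν)) - 1 - (-(x / ν))) := by
    unfold laplacePhase
    field_simp
    ring
  have h1 := add_one_le_exp x
  have h2 := add_one_le_exp (-(x / ν))
  rw [hsplit]
  rcases le_total 0 x with hx | hx
  · have h3 := sq_div_two_le_exp_sub hx
    have h4 : x ^ 2 / (2 * ν) ≤ x ^ 2 / 2 := by
      apply div_le_div_of_nonneg_left (by positivity) (by norm_num) (by linarith)
    have : 0 ≤ ν * (exp (-(x / ν)) - 1 - (-(x / ν))) := mul_nonneg hν0.le (by linarith)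
    linarith
  · have h3 := sq_div_two_le_exp_sub (x := -(x / ν))
      (by have := div_nonpos_of_nonpos_of_nonneg hx hν0.le; linarith)
    have h4 := mul_le_mul_of_nonneg_left h3 hν0.le
    have h5 : ν * ((-(x / ν)) ^ 2 / 2) = x ^ 2 / (2 * ν) := by field_simp
    linarith

lemma abs_laplacePhase_sub_le {ν : ℝ} (hν : 1 ≤ ν) (x : ℝ) :
    |laplacePhase ν x - ((1 + 1 / ν) * x ^ 2 / 2 + (1 - 1 / ν ^ 2) * x ^ 3 / 6)|
      ≤ 2 * x ^ 4 * exp |x| := by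
  have hν0 : 0 < ν := by linarith
  set z := -(x / ν) with hz
  have hsplit : laplacePhase ν x - ((1 + 1 / ν) * x ^ 2 / 2 + (1 - 1 / ν ^ 2) * x ^ 3 / 6) =
      (exp x - (1 + x + x ^ 2 / 2 + x ^ 3 / 6)) +
        ν * (exp z - (1 + z + z ^ 2 / 2 + z ^ 3 / 6)) := by
    unfold laplacePhase
    rw [← hz]
    have hx : x = -(ν * z) := by rw [hz]; field_simp
    rw [hx]
    field_simp
    ring
  rw [hsplit]
  have habs : |z| ≤ |x| := by
    rw [hz, abs_neg, abs_div, abs_of_pos hν0]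
    exact div_le_self (abs_nonneg _) hν
  have h1 := abs_exp_sub_cubic_le x
  have h2 : |ν * (exp z - (1 + z + z ^ 2 / 2 + z ^ 3 / 6))| ≤ x ^ 4 * exp |x| := by
    rw [abs_mul, abs_of_pos hν0]
    calc ν * |exp z - (1 + z + z ^ 2 / 2 + z ^ 3 / 6)| ≤ ν * (z ^ 4 * exp |z|) := by
          gcongr; exact abs_exp_sub_cubic_le z
      _ ≤ ν * (z ^ 4 * exp |x|) := by gcongr
      _ = (ν * z ^ 4) * exp |x| := by ring
      _ ≤ x ^ 4 * exp |x| := by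
          gcongr
          have : ν * z ^ 4 = x ^ 4 / ν ^ 3 := by rw [hz]; field_simp
          rw [this]
          exact div_le_self (by positivity) (one_le_pow₀ hν)
  calc _ ≤ _ := abs_add_le _ _
    _ ≤ 2 * x ^ 4 * exp |x| := by linarith

set_option maxHeartbeats 1000000 in
/-- Comparison of the rescaled Laplace integrand with a Gaussian times a first-order odd
correction. -/
lemma exists_abs_laplaceIntegrand_sub_le {ν : ℝ} (hν : 1 ≤ ν) (c : ℝ) :
    ∃ A, 0 ≤ A ∧ ∀ w, 0 < w → w ≤ 1 → ∀ y : ℝ,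
      |exp (c * (w * y) - (w ^ 2)⁻¹ * laplacePhase ν (w * y)) -
        exp (-((1 + 1 / ν) * y ^ 2 / 2)) * (1 + w * (c * y - (1 - 1 / ν ^ 2) * y ^ 3 / 6))|
        ≤ A * w ^ 2 * exp (-(1 / (4 * ν)) * y ^ 2) := by
  have hν0 : 0 < ν := by linarith
  refine ⟨(2 * (|c| + 49) ^ 2 + 48) * exp (ν * (|c| + 4) ^ 2), by positivity, ?_⟩
  intro w hw hw1 y
  set κ := 1 + 1 / ν with hκ
  set τ := 1 - 1 / ν ^ 2 with hτ
  set L := c * y - τ * y ^ 3 / 6 with hL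
  set P := laplacePhase ν (w * y) with hP
  set h := c * (w * y) - (w ^ 2)⁻¹ * P + κ * y ^ 2 / 2 with hh
  set E := exp (-(κ * y ^ 2 / 2)) with hE
  have hEh : exp (c * (w * y) - (w ^ 2)⁻¹ * P) = E * exp h := by
    rw [hE, hh, ← exp_add]; ring_nf
  have hwy : |w * y| ≤ |y| := by
    rw [abs_mul, abs_of_pos hw]; exact mul_le_of_le_one_left (abs_nonneg _) hw1
  have hpow : ∀ k : ℕ, |y| ^ k ≤ k.factorial * exp |y| := by
    intro k
    have := pow_div_factorial_le_exp |y| (abs_nonneg _) k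
    rwa [div_le_iff₀ (by positivity), mul_comm] at this
  have hy4 : y ^ 4 ≤ 24 * exp |y| := by
    have := hpow 4
    rw [Even.pow_abs (by decide)] at this
    simpa [Nat.factorial] using this
  have hexp2 : exp |y| * exp |y| = exp (2 * |y|) := by rw [← exp_add]; ring_nf
  have hexp4 : exp (2 * |y|) ^ 2 = exp (4 * |y|) := by rw [← exp_nat_mul]; ring_nf
  have hone : exp |y| ≤ exp (2 * |y|) := exp_le_exp.2 (by linarith [abs_nonneg y])
  have hrem : |h - w * L| ≤ 48 * w ^ 2 * exp (2 * |y|) := by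
    have h1 := abs_laplacePhase_sub_le hν (w * y)
    rw [← hP, ← hκ, ← hτ] at h1
    have h2 : h - w * L = -((w ^ 2)⁻¹ * (P - (κ * (w * y) ^ 2 / 2 + τ * (w * y) ^ 3 / 6))) := by
      rw [hh, hL]; field_simp; ring
    rw [h2, abs_neg, abs_mul, abs_of_pos (by positivity)]
    calc _ ≤ (w ^ 2)⁻¹ * (2 * (w * y) ^ 4 * exp |y|) := by
          gcongr
          exact h1.trans (by gcongr)
      _ = 2 * w ^ 2 * (y ^ 4 * exp |y|) := by field_simp
      _ ≤ 2 * w ^ 2 * ((24 * exp |y|) * exp |y|) := by gcongr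
      _ = 48 * w ^ 2 * (exp |y| * exp |y|) := by ring
      _ = _ := by rw [hexp2]
  have hτ1 : |τ| ≤ 1 := by
    have : 1 / ν ^ 2 ≤ 1 := by
      rw [div_le_one (by positivity)]; exact one_le_pow₀ hν
    have h0 : 0 < 1 / ν ^ 2 := by positivity
    rw [abs_le]; constructor <;> linarith
  have hLb : |L| ≤ (|c| + 1) * exp (2 * |y|) := by
    have h1 : |y| ≤ exp |y| := by simpa using hpow 1
    have h3 : |y| ^ 3 ≤ 6 * exp |y| := by simpa [Nat.factorial] using hpow 3
    calc |L| ≤ |c * y| + |τ * y ^ 3 / 6| := abs_sub _ _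
      _ = |c| * |y| + |τ| * |y| ^ 3 / 6 := by
          rw [abs_mul, abs_div, abs_mul, abs_pow, abs_of_pos (by norm_num : (0:ℝ) < 6)]
      _ ≤ |c| * exp (2 * |y|) + 1 * (6 * exp (2 * |y|)) / 6 := by
          gcongr
          · linarith
          · linarith
      _ = _ := by ring
  have hhb : |h| ≤ w * ((|c| + 49) * exp (2 * |y|)) := by
    have e : h = (h - w * L) + w * L := by ring
    calc |h| ≤ |h - w * L| + |w * L| := by conv_lhs => rw [e]
                                           exact abs_add_le _ _
      _ ≤ 48 * w ^ 2 * exp (2 * |y|) + w * ((|c| + 1) * exp (2 * |y|)) := by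
          rw [abs_mul, abs_of_pos hw]; gcongr
      _ ≤ 48 * w * exp (2 * |y|) + w * ((|c| + 1) * exp (2 * |y|)) := by
          gcongr; nlinarith
      _ = _ := by ring
  have hh2 : h ^ 2 ≤ w ^ 2 * ((|c| + 49) ^ 2 * exp (4 * |y|)) := by
    rw [← sq_abs, ← hexp4]
    calc |h| ^ 2 ≤ (w * ((|c| + 49) * exp (2 * |y|))) ^ 2 := by gcongr
      _ = _ := by ring
  set G := exp (-(y ^ 2 / (2 * ν))) with hG
  have hEG : E ≤ G := by
    rw [hE, hG, exp_le_exp, hκ]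
    have : y ^ 2 / (2 * ν) = 1 / ν * y ^ 2 / 2 := by field_simp
    rw [this]; nlinarith [sq_nonneg y]
  have hEG' : E ≤ G * exp (|c| * |y|) :=
    hEG.trans (le_mul_of_one_le_right (exp_pos _).le (one_le_exp (by positivity)))
  have hEhG : E * exp h ≤ G * exp (|c| * |y|) := by
    rw [← hEh, hG, ← exp_add, exp_le_exp]
    have h1 : c * (w * y) ≤ |c| * |y| := by
      calc c * (w * y) ≤ |c * (w * y)| := le_abs_self _
        _ = |c| * |w * y| := abs_mul _ _
        _ ≤ _ := by gcongr
    have h2 := sq_div_le_laplacePhase hν (w * y)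
    rw [← hP] at h2
    have h3 : y ^ 2 / (2 * ν) ≤ (w ^ 2)⁻¹ * P := by
      calc y ^ 2 / (2 * ν) = (w ^ 2)⁻¹ * ((w * y) ^ 2 / (2 * ν)) := by field_simp
        _ ≤ _ := by gcongr
    linarith
  have hfin : G * exp ((|c| + 4) * |y|) ≤
      exp (ν * (|c| + 4) ^ 2) * exp (-(1 / (4 * ν)) * y ^ 2) := by
    rw [hG, ← exp_add, ← exp_add, exp_le_exp]
    set K := |c| + 4
    have e : ν * K ^ 2 + -(1 / (4 * ν)) * y ^ 2 - (-(y ^ 2 / (2 * ν)) + K * |y|) =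
        (1 / (4 * ν)) * (|y| - 2 * ν * K) ^ 2 := by
      rw [← sq_abs y]; field_simp; ring
    have : 0 ≤ (1 / (4 * ν)) * (|y| - 2 * ν * K) ^ 2 := by positivity
    linarith
  have hexpK : exp (|c| * |y|) * exp (4 * |y|) = exp ((|c| + 4) * |y|) := by
    rw [← exp_add]; ring_nf
  have h2K : exp (2 * |y|) ≤ exp ((|c| + 4) * |y|) := by
    apply exp_le_exp.2
    nlinarith [abs_nonneg y, abs_nonneg c, mul_nonneg (abs_nonneg c) (abs_nonneg y)]
  have hEpos : 0 < E := exp_pos _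
  rw [hEh]
  have e : E * exp h - E * (1 + w * L) = E * (exp h - 1 - h) + E * (h - w * L) := by ring
  rw [e]
  calc |E * (exp h - 1 - h) + E * (h - w * L)|
      ≤ E * |exp h - 1 - h| + E * |h - w * L| := by
        refine (abs_add_le _ _).trans_eq ?_
        rw [abs_mul, abs_mul, abs_of_pos hEpos]
    _ ≤ E * (h ^ 2 * (1 + exp h)) + G * (48 * w ^ 2 * exp (2 * |y|)) := by
        gcongr
        exact abs_exp_sub_one_sub_le h
    _ = (E + E * exp h) * h ^ 2 + G * (48 * w ^ 2 * exp (2 * |y|)) := by ring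
    _ ≤ (G * exp (|c| * |y|) + G * exp (|c| * |y|)) *
          (w ^ 2 * ((|c| + 49) ^ 2 * exp (4 * |y|))) +
          G * (48 * w ^ 2 * exp ((|c| + 4) * |y|)) := by gcongr
    _ = (2 * (|c| + 49) ^ 2 + 48) * w ^ 2 * (G * exp ((|c| + 4) * |y|)) := by
        rw [← hexpK]; ring
    _ ≤ (2 * (|c| + 49) ^ 2 + 48) * w ^ 2 *
          (exp (ν * (|c| + 4) ^ 2) * exp (-(1 / (4 * ν)) * y ^ 2)) := by gcongr
    _ = _ := by ring

lemma integrable_pow_mul_exp_neg_mul_sq {b : ℝ} (hb : 0 < b) (k : ℕ) :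
    Integrable fun x : ℝ => x ^ k * exp (-b * x ^ 2) := by
  have := integrable_rpow_mul_exp_neg_mul_sq hb (s := k) (by have : (0:ℝ) ≤ k := by positivity
                                                             linarith)
  simpa using this

lemma integral_eq_zero_of_forall_neg {f : ℝ → ℝ} (hf : ∀ x, f (-x) = -f x) : ∫ x, f x = 0 := by
  have := integral_neg_eq_self f volume
  simp only [hf, integral_neg] at this
  linarith

/-- Laplace's method with a relative error of order `1 / l`. -/
lemma exists_abs_laplaceIntegral_sub_le {ν : ℝ} (hν : 1 ≤ ν) (c : ℝ) :
    ∃ A, 0 ≤ A ∧ ∀ l : ℝ, 1 ≤ l →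
      Integrable (fun x => exp (c * x - l * laplacePhase ν x)) ∧
      |(∫ x, exp (c * x - l * laplacePhase ν x)) - √(2 * π * ν / (ν + 1)) * l ^ (-(1 / 2) : ℝ)|
        ≤ A * l ^ (-(1 / 2) : ℝ) * l⁻¹ := by
  have hν0 : 0 < ν := by linarith
  obtain ⟨A, hA0, hA⟩ := exists_abs_laplaceIntegrand_sub_le hν c
  refine ⟨A * √(π / (1 / (4 * ν))), by positivity, fun l hl => ?_⟩
  have hl0 : 0 < l := by linarith
  set w := l ^ (-(1 / 2) : ℝ) with hw
  have hw0 : 0 < w := rpow_pos_of_pos hl0 _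
  have hw1 : w ≤ 1 := rpow_le_one_of_one_le_of_nonpos hl (by norm_num)
  have hw2 : w ^ 2 = l⁻¹ := by
    rw [hw, ← rpow_natCast, ← rpow_mul hl0.le, ← rpow_neg_one]; norm_num
  have hlw : l = (w ^ 2)⁻¹ := by rw [hw2, inv_inv]
  set κ := 1 + 1 / ν with hκ
  have hκ0 : 0 < κ := by positivity
  set τ := 1 - 1 / ν ^ 2 with hτ
  set F : ℝ → ℝ := fun x => exp (c * x - l * laplacePhase ν x) with hF
  set g : ℝ → ℝ := fun y =>
    exp (-(κ * y ^ 2 / 2)) * (1 + w * (c * y - τ * y ^ 3 / 6)) with hg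
  have hbound : ∀ y, |F (w * y) - g y| ≤ A * w ^ 2 * exp (-(1 / (4 * ν)) * y ^ 2) := by
    intro y
    have := hA w hw0 hw1 y
    rw [← hlw] at this
    exact this
  have hgauss (k : ℕ) : Integrable fun y : ℝ => y ^ k * exp (-(κ / 2) * y ^ 2) :=
    integrable_pow_mul_exp_neg_mul_sq (by positivity) k
  have hmaj : Integrable fun y : ℝ => A * w ^ 2 * exp (-(1 / (4 * ν)) * y ^ 2) :=
    (integrable_exp_neg_mul_sq (by positivity)).const_mul _
  have hgeq : g = fun y => exp (-(κ / 2) * y ^ 2) + (w * c * (y ^ 1 * exp (-(κ / 2) * y ^ 2)) -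
      w * τ / 6 * (y ^ 3 * exp (-(κ / 2) * y ^ 2))) := by
    funext y
    simp only [hg]
    rw [show -(κ * y ^ 2 / 2) = -(κ / 2) * y ^ 2 by ring]
    ring
  have hodd : Integrable fun y => (w * c * (y ^ 1 * exp (-(κ / 2) * y ^ 2)) -
      w * τ / 6 * (y ^ 3 * exp (-(κ / 2) * y ^ 2))) :=
    ((hgauss 1).const_mul _).sub ((hgauss 3).const_mul _)
  have hg0 : Integrable fun y : ℝ => exp (-(κ / 2) * y ^ 2) :=
    integrable_exp_neg_mul_sq (by positivity)
  have hgint : Integrable g := by rw [hgeq]; exact hg0.add hodd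
  have hgval : ∫ y, g y = √(2 * π * ν / (ν + 1)) := by
    rw [hgeq, integral_add hg0 hodd, integral_gaussian, integral_eq_zero_of_forall_neg, add_zero]
    · congr 1; rw [hκ]; field_simp
    · intro x; simp only [neg_sq]; ring
  have hFc : Continuous F := by
    simp only [hF]; unfold laplacePhase; fun_prop
  have hdiff : Integrable fun y => F (w * y) - g y := by
    refine hmaj.mono' ?_ (ae_of_all _ hbound)
    apply Continuous.aestronglyMeasurable
    simp only [hg]
    fun_prop
  have hFw : Integrable fun y => F (w * y) := by
    exact (hdiff.add hgint).congr (ae_of_all _ fun y => by simp)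
  have hFint : Integrable F := by
    have := hFw.comp_mul_left' (R := w⁻¹) (by positivity)
    simpa [mul_inv_cancel_left₀ hw0.ne'] using this
  refine ⟨hFint, ?_⟩
  have hscale : ∫ x, F x = w * ∫ y, F (w * y) := by
    rw [Measure.integral_comp_mul_left, abs_of_pos (by positivity), smul_eq_mul,
      mul_inv_cancel_left₀ hw0.ne']
  rw [hscale, ← hgval, mul_comm _ w, ← mul_sub, ← integral_sub hFw hgint, abs_mul,
    abs_of_pos hw0]
  calc w * |∫ y, (F (w * y) - g y)|
      ≤ w * ∫ y, A * w ^ 2 * exp (-(1 / (4 * ν)) * y ^ 2) := by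
        gcongr
        rw [← norm_eq_abs]
        exact norm_integral_le_of_norm_le hmaj (ae_of_all _ fun y => hbound y)
    _ = _ := by
        rw [integral_const_mul, integral_gaussian, hw2]; ring

/-- The unnormalised Gamma density of shape `a`, extended by zero to the real line. -/
noncomputable def gammaKernel (a y : ℝ) : ℝ :=
  (Set.Ioi (0 : ℝ)).indicator (fun y => exp (-y) * y ^ (a - 1)) y

lemma gammaKernel_of_pos (a : ℝ) {y : ℝ} (hy : 0 < y) :
    gammaKernel a y = exp (-y) * y ^ (a - 1) :=
  Set.indicator_of_mem (Set.mem_Ioi.2 hy) _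

lemma gammaKernel_of_nonpos (a : ℝ) {y : ℝ} (hy : y ≤ 0) : gammaKernel a y = 0 :=
  Set.indicator_of_notMem (by simpa using hy) _

lemma gammaKernel_nonneg (a y : ℝ) : 0 ≤ gammaKernel a y := by
  rcases lt_or_ge 0 y with hy | hy
  · rw [gammaKernel_of_pos a hy]; positivity
  · rw [gammaKernel_of_nonpos a hy]

lemma integrable_gammaKernel {a : ℝ} (ha : 0 < a) : Integrable (gammaKernel a) :=
  (integrable_indicator_iff measurableSet_Ioi).2 (GammaIntegral_convergent ha)

/-- The unnormalised probability that a product of independent Gamma variables of shapes `α`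
exceeds `t`. -/
noncomputable def gammaTail {n : ℕ} (α : Fin n → ℝ) (t : ℝ) : ℝ :=
  ∫ x : Fin n → ℝ, {x : Fin n → ℝ | t < ∏ a, x a}.indicator
    (fun x => ∏ a, gammaKernel (α a) (x a)) x

lemma measurableSet_lt_prod {n : ℕ} (t : ℝ) :
    MeasurableSet {x : Fin n → ℝ | t < ∏ a, x a} :=
  measurableSet_lt measurable_const (by fun_prop)

lemma integrable_prod_gammaKernel {n : ℕ} {α : Fin n → ℝ} (hα : ∀ a, 0 < α a) :
    Integrable fun x : Fin n → ℝ => ∏ a, gammaKernel (α a) (x a) :=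
  Integrable.fintype_prod fun a => integrable_gammaKernel (hα a)

lemma abs_gammaTail_le {n : ℕ} {α : Fin n → ℝ} (hα : ∀ a, 0 < α a) (t : ℝ) :
    |gammaTail α t| ≤ ∫ x : Fin n → ℝ, ∏ a, gammaKernel (α a) (x a) := by
  rw [← norm_eq_abs]
  refine norm_integral_le_of_norm_le (integrable_prod_gammaKernel hα) (ae_of_all _ fun x => ?_)
  have h : 0 ≤ ∏ a, gammaKernel (α a) (x a) :=
    Finset.prod_nonneg fun a _ => gammaKernel_nonneg _ _
  refine (norm_indicator_le_norm_self _ _).trans_eq ?_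
  rw [norm_eq_abs, abs_of_nonneg h]

lemma gammaTail_succ {n : ℕ} {α : Fin (n + 1) → ℝ} (hα : ∀ a, 0 < α a) (t : ℝ) :
    Integrable (fun y => gammaKernel (α 0) y * gammaTail (fun i => α (Fin.succ i)) (t / y)) ∧
    gammaTail α t =
      ∫ y, gammaKernel (α 0) y * gammaTail (fun i => α (Fin.succ i)) (t / y) := by
  set e := MeasurableEquiv.piFinSuccAbove (fun _ : Fin (n + 1) => ℝ) 0 with he
  have hmp : MeasurePreserving e := volume_preserving_piFinSuccAbove (fun _ => ℝ) 0
  set g : ℝ × (Fin n → ℝ) → ℝ := fun z =>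
    {z : ℝ × (Fin n → ℝ) | t < z.1 * ∏ a, z.2 a}.indicator
      (fun z => gammaKernel (α 0) z.1 * ∏ a, gammaKernel (α (Fin.succ a)) (z.2 a)) z with hg
  have hgint : Integrable g (volume.prod volume) := by
    refine Integrable.indicator ?_ (measurableSet_lt measurable_const (by fun_prop))
    exact (integrable_gammaKernel (hα 0)).mul_prod
      (integrable_prod_gammaKernel fun a => hα (Fin.succ a))
  have hinner (y : ℝ) : ∫ x : Fin n → ℝ, g (y, x) =
      gammaKernel (α 0) y * gammaTail (fun i => α (Fin.succ i)) (t / y) := by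
    rcases lt_or_ge 0 y with hy | hy
    · rw [gammaTail, ← integral_const_mul]
      congr 1
      funext x
      simp only [hg, Set.indicator_apply, Set.mem_ofPred_eq, div_lt_iff₀' hy, mul_ite, mul_zero]
    · rw [gammaKernel_of_nonpos _ hy, zero_mul]
      simp [hg, gammaKernel_of_nonpos _ hy, Set.indicator_apply]
  have h1 := hgint.integral_prod_left
  simp only [hinner] at h1
  refine ⟨h1, ?_⟩
  have h2 := integral_prod g hgint
  simp only [hinner] at h2
  rw [← h2, ← Measure.volume_eq_prod, ← hmp.integral_comp' g, gammaTail]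
  congr 1
  funext x
  simp [hg, he, Set.indicator_apply, Fin.prod_univ_succ, MeasurableEquiv.piFinSuccAbove, Fin.tail]
  congr 1

lemma gammaTail_fin_one {α : Fin 1 → ℝ} (hα : ∀ a, 0 < α a) {t : ℝ} (ht : 0 < t) :
    gammaTail α t = ∫ y in Set.Ioi t, exp (-y) * y ^ (α 0 - 1) := by
  rw [(gammaTail_succ hα t).2, ← integral_indicator measurableSet_Ioi]
  congr 1
  funext y
  rcases lt_or_ge 0 y with hy | hy
  · have hvol : (volume : Measure (Fin 0 → ℝ)) = Measure.dirac isEmptyElim :=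
      Measure.volume_pi_eq_dirac _
    rw [gammaKernel_of_pos _ hy, gammaTail, hvol, integral_dirac]
    simp [Set.indicator_apply, div_lt_one hy]
  · rw [gammaKernel_of_nonpos _ hy, zero_mul, Set.indicator_of_notMem]
    simp; linarith

/-- The substitution `y = l * exp x` in an integral over the positive half-line. -/
lemma integral_comp_mul_exp {F : ℝ → ℝ} {l : ℝ} (hl : 0 < l) (hF : Integrable F)
    (hF0 : ∀ y ≤ 0, F y = 0) :
    Integrable (fun x => l * exp x * F (l * exp x)) ∧
      ∫ y, F y = ∫ x, l * exp x * F (l * exp x) := by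
  have himg : (fun x => l * exp x) '' Set.univ = Set.Ioi 0 := by
    ext y
    simp only [Set.image_univ, Set.mem_range, Set.mem_Ioi]
    constructor
    · rintro ⟨x, rfl⟩; positivity
    · intro hy
      exact ⟨log (y / l), by rw [exp_log (by positivity)]; field_simp⟩
  have hderiv : ∀ x ∈ Set.univ, HasDerivWithinAt (fun x => l * exp x) (l * exp x) Set.univ x :=
    fun x _ => ((hasDerivAt_exp x).const_mul l).hasDerivWithinAt
  have hinj : Set.InjOn (fun x => l * exp x) Set.univ := by
    intro x _ y _ h
    exact exp_injective (mul_left_cancel₀ hl.ne' h)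
  have habs (x : ℝ) : |l * exp x| = l * exp x := abs_of_pos (by positivity)
  constructor
  · have := (integrableOn_image_iff_integrableOn_abs_deriv_smul MeasurableSet.univ hderiv hinj
      F).1 hF.integrableOn
    simpa only [habs, smul_eq_mul, integrableOn_univ] using this
  · have := integral_image_eq_integral_abs_deriv_smul MeasurableSet.univ hderiv hinj F
    simp only [habs, smul_eq_mul, setIntegral_univ, himg] at this
    rw [← this]
    symm
    apply setIntegral_eq_integral_of_forall_compl_eq_zero
    intro y hy
    exact hF0 y (by simpa using hy)

lemma abs_exp_sub_one_le_mul_exp (x : ℝ) : |exp x - 1| ≤ |x| * exp |x| := by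
  have h := Complex.norm_exp_sub_sum_le_norm_mul_exp (x : ℂ) 1
  simp only [Finset.sum_range_succ, Finset.sum_range_zero, Nat.factorial, Complex.norm_real] at h
  rw [← norm_eq_abs, ← Complex.norm_real]
  convert! h using 2
  · push_cast
    simp
  · simp

/-- Leading-order asymptotics of the incomplete Gamma integral. -/
lemma exists_abs_incompleteGamma_sub_le (b : ℝ) :
    ∃ C, ∀ μ : ℝ, 1 ≤ μ →
      |(∫ y in Set.Ioi μ, exp (-y) * y ^ b) - exp (-μ) * μ ^ b|
        ≤ C * (exp (-μ) * μ ^ (b - 1)) := by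
  set k := 4 * |b| + 1 with hk
  have hk0 : 0 < k := by positivity
  set D := |b| * 4 * exp (1 / 4 + |b| * log k) with hD
  refine ⟨D * 2, fun μ hμ => ?_⟩
  have hμ0 : 0 < μ := by linarith
  have hpt : ∀ v, 0 < v → |exp (-(v + μ)) * (v + μ) ^ b - exp (-v) * (exp (-μ) * μ ^ b)| ≤
      D * (exp (-μ) * μ ^ (b - 1)) * exp (-(1 / 2) * v) := by
    intro v hv
    set w := v / μ with hw
    have hw0 : 0 < w := by positivity
    have hwv : w ≤ v := div_le_self hv.le hμ
    have hfac : (v + μ) ^ b = μ ^ b * exp (b * log (1 + w)) := by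
      rw [show v + μ = μ * (1 + w) by rw [hw]; field_simp; ring,
        mul_rpow hμ0.le (by positivity), rpow_def_of_pos (x := 1 + w) (by positivity), mul_comm b]
    have hl0 : 0 ≤ log (1 + w) := log_nonneg (by linarith)
    have hl1 : log (1 + w) ≤ w := by
      have := log_le_sub_one_of_pos (show 0 < 1 + w by positivity); linarith
    have hl2 : |b| * log (1 + w) ≤ 1 / 4 + |b| * log k + v / 4 := by
      have h1 : log (1 + w) ≤ (1 + v) / k + log k := by
        have h2 := log_le_sub_one_of_pos (show 0 < (1 + w) / k by positivity)
        rw [log_div (by positivity) (by positivity)] at h2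
        have : (1 + w) / k ≤ (1 + v) / k := by gcongr
        linarith
      have h3 : |b| / k ≤ 1 / 4 := by
        rw [div_le_iff₀ hk0, hk]; linarith
      calc |b| * log (1 + w) ≤ |b| * ((1 + v) / k + log k) := by gcongr
        _ = |b| / k * (1 + v) + |b| * log k := by ring
        _ ≤ 1 / 4 * (1 + v) + |b| * log k := by gcongr
        _ = _ := by ring
    have hv4 : v ≤ 4 * exp (v / 4) := by
      have := add_one_le_exp (v / 4); linarith
    have hkey : |exp (b * log (1 + w)) - 1| ≤ D * μ⁻¹ * exp (v / 2) := by
      refine (abs_exp_sub_one_le_mul_exp _).trans ?_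
      rw [abs_mul, abs_of_nonneg hl0]
      calc |b| * log (1 + w) * exp (|b| * log (1 + w))
          ≤ |b| * w * exp (1 / 4 + |b| * log k + v / 4) := by gcongr
        _ = |b| * μ⁻¹ * v * (exp (1 / 4 + |b| * log k) * exp (v / 4)) := by
            rw [← exp_add, hw]; ring
        _ ≤ |b| * μ⁻¹ * (4 * exp (v / 4)) * (exp (1 / 4 + |b| * log k) * exp (v / 4)) := by
            gcongr
        _ = |b| * 4 * exp (1 / 4 + |b| * log k) * μ⁻¹ * (exp (v / 4) * exp (v / 4)) := by ring
        _ = _ := by rw [← exp_add, hD]; ring_nf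
    have he : exp (-(v + μ)) * (v + μ) ^ b - exp (-v) * (exp (-μ) * μ ^ b) =
        exp (-v) * (exp (-μ) * μ ^ b) * (exp (b * log (1 + w)) - 1) := by
      rw [hfac, neg_add, exp_add]; ring
    rw [he, abs_mul, abs_of_pos (by positivity)]
    calc _ ≤ exp (-v) * (exp (-μ) * μ ^ b) * (D * μ⁻¹ * exp (v / 2)) := by gcongr
      _ = D * (exp (-μ) * (μ ^ b * μ⁻¹)) * (exp (-v) * exp (v / 2)) := by ring
      _ = _ := by
        rw [← exp_add, rpow_sub_one hμ0.ne', div_eq_mul_inv]; ring_nf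
  have hshift : ∫ y in Set.Ioi μ, exp (-y) * y ^ b =
      ∫ v in Set.Ioi (0 : ℝ), exp (-(v + μ)) * (v + μ) ^ b := by
    have := (measurePreserving_add_right volume μ).setIntegral_preimage_emb
      (measurableEmbedding_addRight μ) (fun y => exp (-y) * y ^ b) (Set.Ioi μ)
    simpa using this.symm
  have hexp : IntegrableOn (fun v : ℝ => exp (-v)) (Set.Ioi 0) := by
    simpa using exp_neg_integrableOn_Ioi 0 (one_pos)
  have hexp2 : IntegrableOn (fun v : ℝ => exp (-(1 / 2) * v)) (Set.Ioi 0) :=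
    exp_neg_integrableOn_Ioi 0 (by norm_num)
  have hexp2v : ∫ v in Set.Ioi (0 : ℝ), exp (-(1 / 2) * v) = 2 := by
    rw [integral_exp_mul_Ioi (by norm_num)]; norm_num
  have hmain : IntegrableOn (fun v => exp (-v) * (exp (-μ) * μ ^ b)) (Set.Ioi 0) :=
    hexp.mul_const _
  have hdiff : IntegrableOn (fun v =>
      exp (-(v + μ)) * (v + μ) ^ b - exp (-v) * (exp (-μ) * μ ^ b)) (Set.Ioi 0) := by
    refine (hexp2.const_mul (D * (exp (-μ) * μ ^ (b - 1)))).mono' ?_ ?_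
    · exact Measurable.aestronglyMeasurable (by fun_prop)
    · exact (ae_restrict_iff' measurableSet_Ioi).2 (ae_of_all _ fun v hv => hpt v hv)
  have hfull : IntegrableOn (fun v => exp (-(v + μ)) * (v + μ) ^ b) (Set.Ioi 0) :=
    (hdiff.add hmain).congr (ae_of_all _ fun v => by simp)
  have hval : exp (-μ) * μ ^ b = ∫ v in Set.Ioi (0 : ℝ), exp (-v) * (exp (-μ) * μ ^ b) := by
    rw [integral_mul_const, integral_exp_neg_Ioi_zero, one_mul]
  rw [hshift, hval, ← integral_sub hfull hmain, ← norm_eq_abs]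
  refine (norm_integral_le_of_norm_le (hexp2.const_mul (D * (exp (-μ) * μ ^ (b - 1)))) ?_).trans_eq
    ?_
  · exact (ae_restrict_iff' measurableSet_Ioi).2 (ae_of_all _ fun v hv => hpt v hv)
  · rw [integral_const_mul, hexp2v]; ring

/-- Convolving a tail function with a Gamma density propagates its asymptotics. -/
lemma exists_abs_integral_gammaKernel_mul_sub_le {n : ℕ} {T : ℝ → ℝ} {a B c C δ : ℝ}
    (hB : ∀ t, |T t| ≤ B)
    (hint : ∀ t, Integrable fun y => gammaKernel a y * T (t / y))
    (hT : ∀ μ : ℝ, 1 ≤ μ → |T (μ ^ (n + 1)) - c * (exp (-((n + 1 : ℕ) * μ)) * μ ^ δ)| ≤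
      C * (exp (-((n + 1 : ℕ) * μ)) * μ ^ (δ - 1))) :
    ∃ C', ∀ l : ℝ, 1 ≤ l →
      |(∫ y, gammaKernel a y * T (l ^ (n + 2) / y)) -
          c * √(2 * π * (n + 1 : ℕ) / ((n + 1 : ℕ) + 1)) *
            (exp (-((n + 2 : ℕ) * l)) * l ^ (a + δ - 1 / 2))| ≤
        C' * (exp (-((n + 2 : ℕ) * l)) * l ^ (a + δ - 1 / 2 - 1)) := by
  set ν : ℝ := ((n + 1 : ℕ) : ℝ) with hνdef
  have hν : 1 ≤ ν := by rw [hνdef]; exact_mod_cast Nat.succ_le_succ (Nat.zero_le n)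
  have hν0 : 0 < ν := by linarith
  have hν1 : ((n + 2 : ℕ) : ℝ) = ν + 1 := by rw [hνdef]; push_cast; ring
  rw [hν1]
  set S := √(2 * π * ν / (ν + 1)) with hS
  have hB0 : 0 ≤ B := (abs_nonneg _).trans (hB 0)
  set M := |δ| + 1 with hM
  have hC0 : 0 ≤ C := by
    have h := (abs_nonneg _).trans (hT 1 le_rfl)
    rw [one_rpow, mul_one] at h
    exact nonneg_of_mul_nonneg_left h (exp_pos _)
  set C₁ := C + (B + |c|) * exp ν with hC₁
  have hC₁0 : 0 ≤ C₁ := by positivity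
  -- the asymptotics of `T`, extended to all positive arguments
  have hglob : ∀ μ : ℝ, 0 < μ → |T (μ ^ (n + 1)) - c * (exp (-(ν * μ)) * μ ^ δ)| ≤
      C₁ * (exp (-(ν * μ)) * (μ ^ (δ - 1) + μ ^ (-M))) := by
    intro μ hμ
    rcases le_total 1 μ with h1 | h1
    · refine (hT μ h1).trans ?_
      have : 0 < μ ^ (-M) := rpow_pos_of_pos hμ _
      have hCC : C ≤ C₁ := by rw [hC₁]; linarith [show 0 ≤ (B + |c|) * exp ν by positivity]
      gcongr
      linarith
    · have hδ : μ ^ δ ≤ μ ^ (-M) :=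
        rpow_le_rpow_of_exponent_ge hμ h1 (by rw [hM]; linarith [neg_abs_le δ])
      have h1M : 1 ≤ μ ^ (-M) :=
        one_le_rpow_of_pos_of_le_one_of_nonpos hμ h1 (by rw [hM]; linarith [abs_nonneg δ])
      have hE1 : exp (-(ν * μ)) ≤ 1 := exp_le_one_iff.2 (by have := mul_pos hν0 hμ; linarith)
      have hE2 : 1 ≤ exp ν * exp (-(ν * μ)) := by
        rw [← exp_add]; apply one_le_exp; nlinarith
      have hp : 0 < μ ^ (δ - 1) := rpow_pos_of_pos hμ _
      calc _ ≤ |T (μ ^ (n + 1))| + |c * (exp (-(ν * μ)) * μ ^ δ)| := abs_sub _ _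
        _ ≤ B * μ ^ (-M) + |c| * (1 * μ ^ (-M)) := by
            rw [abs_mul, abs_of_pos (show 0 < exp (-(ν * μ)) * μ ^ δ by positivity)]
            gcongr
            exact (hB _).trans (le_mul_of_one_le_right hB0 h1M)
        _ = (B + |c|) * μ ^ (-M) * 1 := by ring
        _ ≤ (B + |c|) * μ ^ (-M) * (exp ν * exp (-(ν * μ))) := by gcongr
        _ = ((B + |c|) * exp ν) * (exp (-(ν * μ)) * (0 + μ ^ (-M))) := by ring
        _ ≤ _ := by
            rw [hC₁]
            gcongr
            linarith
  set q : ℝ → ℝ → ℝ → ℝ := fun s l x => exp ((a - s / ν) * x - l * laplacePhase ν x) with hq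
  obtain ⟨A₀, hA₀, hJ₀⟩ := exists_abs_laplaceIntegral_sub_le hν (a - δ / ν)
  obtain ⟨A₁, hA₁, hJ₁⟩ := exists_abs_laplaceIntegral_sub_le hν (a - (δ - 1) / ν)
  obtain ⟨A₂, hA₂, hJ₂⟩ := exists_abs_laplaceIntegral_sub_le hν (a - (-M) / ν)
  refine ⟨|c| * A₀ + C₁ * ((S + A₁) + (S + A₂)), fun l hl => ?_⟩
  have hl0 : 0 < l := by linarith
  set E := exp (-((ν + 1) * l)) with hE
  have hEpos : 0 < E := exp_pos _
  obtain ⟨hi₀, hJ₀⟩ := hJ₀ l hl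
  obtain ⟨hi₁, hJ₁⟩ := hJ₁ l hl
  obtain ⟨hi₂, hJ₂⟩ := hJ₂ l hl
  set J₀ := ∫ x, exp ((a - δ / ν) * x - l * laplacePhase ν x)
  set J₁ := ∫ x, exp ((a - (δ - 1) / ν) * x - l * laplacePhase ν x)
  set J₂ := ∫ x, exp ((a - (-M) / ν) * x - l * laplacePhase ν x)
  set w := l ^ (-(1 / 2) : ℝ) with hw
  have hw0 : 0 < w := rpow_pos_of_pos hl0 _
  have hinv : l⁻¹ ≤ 1 := inv_le_one_of_one_le₀ hl
  have hupper {J A : ℝ} (hA : 0 ≤ A) (hJ : |J - S * w| ≤ A * w * l⁻¹) : J ≤ (S + A) * w := by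
    have h1 := (abs_le.1 hJ).2
    have h2 : A * w * l⁻¹ ≤ A * w := mul_le_of_le_one_right (by positivity) hinv
    linarith
  obtain ⟨hFint, hFeq⟩ := integral_comp_mul_exp hl0 (hint (l ^ (n + 2)))
    (fun y hy => by rw [gammaKernel_of_nonpos a hy, zero_mul])
  set W : ℝ → ℝ := fun x => exp (-(l * exp x)) * (l * exp x) ^ a with hW
  set m : ℝ → ℝ := fun x => l * exp (-(x / ν)) with hm
  have hm0 (x : ℝ) : 0 < m x := by simp only [hm]; positivity
  have hFx (x : ℝ) : l * exp x * (gammaKernel a (l * exp x) * T (l ^ (n + 2) / (l * exp x))) =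
      W x * T (m x ^ (n + 1)) := by
    have hpos : 0 < l * exp x := by positivity
    have h1 : l ^ (n + 2) / (l * exp x) = m x ^ (n + 1) := by
      simp only [hm]
      rw [mul_pow, ← exp_nat_mul, ← hνdef, show ν * -(x / ν) = -x by field_simp, exp_neg]
      field_simp
      ring
    rw [gammaKernel_of_pos a hpos, h1, rpow_sub_one hpos.ne']
    simp only [hW]
    field_simp
  simp only [hFx] at hFint hFeq
  have hWm (s x : ℝ) : W x * (exp (-(ν * m x)) * m x ^ s) = E * l ^ (a + s) * q s l x := by
    have hlog1 : (l * exp x) ^ a = exp (a * (log l + x)) := by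
      rw [rpow_def_of_pos (by positivity), log_mul hl0.ne' (exp_pos x).ne', log_exp, mul_comm]
    have hlog2 : m x ^ s = exp (s * (log l - x / ν)) := by
      rw [rpow_def_of_pos (hm0 x)]
      simp only [hm]
      rw [log_mul hl0.ne' (exp_pos _).ne', log_exp]; ring_nf
    simp only [hW, hq]
    rw [hlog1, hlog2, rpow_def_of_pos hl0, hE, ← exp_add, ← exp_add, ← exp_add, ← exp_add,
      ← exp_add]
    congr 1
    simp only [hm, laplacePhase]
    field_simp
    ring
  have hW0 (x : ℝ) : 0 ≤ W x := by simp only [hW]; positivity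
  have hmainint : Integrable fun x => c * (E * l ^ (a + δ) * q δ l x) :=
    (hi₀.const_mul _).const_mul _
  have herrint : Integrable fun x => C₁ * (E * l ^ (a + (δ - 1)) * q (δ - 1) l x +
      E * l ^ (a + -M) * q (-M) l x) :=
    ((hi₁.const_mul _).add (hi₂.const_mul _)).const_mul _
  have hpt (x : ℝ) : ‖W x * T (m x ^ (n + 1)) - c * (E * l ^ (a + δ) * q δ l x)‖ ≤
      C₁ * (E * l ^ (a + (δ - 1)) * q (δ - 1) l x + E * l ^ (a + -M) * q (-M) l x) := by
    rw [← hWm, ← hWm, ← hWm, norm_eq_abs]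
    calc _ = W x * |T (m x ^ (n + 1)) - c * (exp (-(ν * m x)) * m x ^ δ)| := by
          rw [← abs_of_nonneg (hW0 x), ← abs_mul, abs_of_nonneg (hW0 x)]; ring_nf
      _ ≤ W x * (C₁ * (exp (-(ν * m x)) * (m x ^ (δ - 1) + m x ^ (-M)))) := by
          exact mul_le_mul_of_nonneg_left (hglob _ (hm0 x)) (hW0 x)
      _ = _ := by ring
  have hcmp := norm_integral_le_of_norm_le herrint (ae_of_all _ hpt)
  rw [integral_sub hFint hmainint, integral_const_mul, integral_const_mul, integral_const_mul,
    integral_add (hi₁.const_mul _) (hi₂.const_mul _), integral_const_mul, integral_const_mul,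
    ← hFeq, norm_eq_abs] at hcmp
  change |_ - c * (E * l ^ (a + δ) * J₀)| ≤
    C₁ * (E * l ^ (a + (δ - 1)) * J₁ + E * l ^ (a + -M) * J₂) at hcmp
  have hpw : l ^ (a + δ - 1 / 2) = l ^ (a + δ) * w := by
    rw [hw, ← rpow_add hl0]; ring_nf
  have hpw1 : l ^ (a + δ - 1 / 2 - 1) = l ^ (a + δ) * w * l⁻¹ := by
    rw [rpow_sub_one hl0.ne', hpw, div_eq_mul_inv]
  have hpw2 : l ^ (a + (δ - 1)) = l ^ (a + δ) * l⁻¹ := by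
    rw [← add_sub_assoc, rpow_sub_one hl0.ne', div_eq_mul_inv]
  have hpw3 : l ^ (a + -M) ≤ l ^ (a + δ) * l⁻¹ := by
    rw [← hpw2]
    exact rpow_le_rpow_of_exponent_le hl (by rw [hM]; linarith [neg_abs_le δ])
  have hP : 0 < l ^ (a + δ) := rpow_pos_of_pos hl0 _
  have hJ₁' := hupper hA₁ hJ₁
  have hJ₂' := hupper hA₂ hJ₂
  have hJ₁0 : 0 ≤ J₁ := integral_nonneg fun x => (exp_pos _).le
  have hJ₂0 : 0 ≤ J₂ := integral_nonneg fun x => (exp_pos _).le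
  rw [hpw, hpw1]
  calc _ = |((∫ y, gammaKernel a y * T (l ^ (n + 2) / y)) - c * (E * l ^ (a + δ) * J₀)) +
          c * (E * l ^ (a + δ)) * (J₀ - S * w)| := by ring_nf
    _ ≤ C₁ * (E * l ^ (a + (δ - 1)) * J₁ + E * l ^ (a + -M) * J₂) +
          |c| * (E * l ^ (a + δ)) * (A₀ * w * l⁻¹) := by
        refine (abs_add_le _ _).trans ?_
        rw [abs_mul, abs_mul, abs_of_pos (show 0 < E * l ^ (a + δ) by positivity)]
        gcongr
    _ ≤ C₁ * (E * (l ^ (a + δ) * l⁻¹) * ((S + A₁) * w) +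
          E * (l ^ (a + δ) * l⁻¹) * ((S + A₂) * w)) +
          |c| * (E * l ^ (a + δ)) * (A₀ * w * l⁻¹) := by
        rw [hpw2]; gcongr
    _ = _ := by ring

/-- Asymptotics of the tail of a product of independent Gamma variables. -/
lemma exists_abs_gammaTail_sub_le (n : ℕ) {α : Fin (n + 1) → ℝ} (hα : ∀ a, 0 < α a) :
    ∃ C, ∀ μ : ℝ, 1 ≤ μ →
      |gammaTail α (μ ^ (n + 1)) - (2 * π) ^ ((n : ℝ) / 2) / √(n + 1 : ℕ) *
          (exp (-((n + 1 : ℕ) * μ)) * μ ^ (∑ a, α a - ((n : ℝ) + 2) / 2))| ≤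
        C * (exp (-((n + 1 : ℕ) * μ)) * μ ^ (∑ a, α a - ((n : ℝ) + 2) / 2 - 1)) := by
  induction n with
  | zero =>
    obtain ⟨C, hC⟩ := exists_abs_incompleteGamma_sub_le (α 0 - 1)
    refine ⟨C, fun μ hμ => ?_⟩
    have := hC μ hμ
    rw [← gammaTail_fin_one hα (by linarith)] at this
    simpa using this
  | succ n ih =>
    obtain ⟨C, hC⟩ := ih (α := fun i => α i.succ) fun i => hα i.succ
    obtain ⟨C', hC'⟩ := exists_abs_integral_gammaKernel_mul_sub_le (n := n)
      (abs_gammaTail_le fun i => hα (Fin.succ i)) (fun t => (gammaTail_succ hα t).1) hC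
    refine ⟨C', fun μ hμ => ?_⟩
    have := hC' μ hμ
    rw [← (gammaTail_succ hα _).2] at this
    have hexp : α 0 + (∑ i : Fin (n + 1), α i.succ - ((n : ℝ) + 2) / 2) - 1 / 2 =
        ∑ a, α a - (((n + 1 : ℕ) : ℝ) + 2) / 2 := by
      rw [Fin.sum_univ_succ (n := n + 1)]; push_cast; ring
    have hconst : (2 * π) ^ ((n : ℝ) / 2) / √(n + 1 : ℕ) *
        √(2 * π * (n + 1 : ℕ) / ((n + 1 : ℕ) + 1)) =
        (2 * π) ^ (((n + 1 : ℕ) : ℝ) / 2) / √(n + 1 + 1 : ℕ) := by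
      have h1 : (((n + 1 : ℕ) : ℝ)) / 2 = (n : ℝ) / 2 + 1 / 2 := by push_cast; ring
      rw [h1, rpow_add (by positivity), ← sqrt_eq_rpow, sqrt_div (by positivity),
        sqrt_mul (by positivity)]
      have : √((n + 1 : ℕ) : ℝ) ≠ 0 := by positivity
      push_cast at this ⊢
      field_simp
    rw [hexp, hconst] at this
    exact this

lemma setIntegral_prod_gamma_eq {n : ℕ} (α : Fin n → ℝ) (t : ℝ) :
    ∫ x : Fin n → ℝ in {x | (∀ a, 0 < x a) ∧ t < ∏ a, x a},
      ∏ a, x a ^ (α a - 1) * exp (-x a) / Gamma (α a) =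
    gammaTail α t / ∏ a, Gamma (α a) := by
  set A := {x : Fin n → ℝ | (∀ a, 0 < x a) ∧ t < ∏ a, x a} with hA
  have hmem (x : Fin n → ℝ) : x ∈ A ↔ (∀ a, 0 < x a) ∧ t < ∏ a, x a := Iff.rfl
  have hmeas : MeasurableSet A := by
    have : A = (⋂ a, {x : Fin n → ℝ | 0 < x a}) ∩ {x | t < ∏ a, x a} := by
      ext x; simp [hA]
    rw [this]
    exact (MeasurableSet.iInter fun a =>
      measurableSet_lt measurable_const (measurable_pi_apply a)).inter (measurableSet_lt_prod t)
  rw [← integral_indicator hmeas, gammaTail, ← integral_div]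
  congr 1
  funext x
  simp only [Set.indicator_apply, hmem, Set.mem_ofPred_eq]
  by_cases hx : ∀ a, 0 < x a
  · by_cases ht : t < ∏ a, x a
    · rw [if_pos ⟨hx, ht⟩, if_pos ht, ← Finset.prod_div_distrib]
      refine Finset.prod_congr rfl fun a _ => ?_
      rw [gammaKernel_of_pos _ (hx a), mul_comm (exp _)]
    · rw [if_neg fun h => ht h.2, if_neg ht, zero_div]
  · rw [if_neg fun h => hx h.1]
    obtain ⟨a, ha⟩ := not_forall.1 hx
    have h0 : ∏ a, gammaKernel (α a) (x a) = 0 :=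
      Finset.prod_eq_zero (Finset.mem_univ a) (gammaKernel_of_nonpos _ (not_lt.1 ha))
    simp [h0]

lemma exists_abs_prod_sub_one_le {ι : Type*} (s : Finset ι) (f : ι → ℝ → ℝ)
    (hf : ∀ k ∈ s, ∃ C, ∀ μ : ℝ, 1 ≤ μ → |f k μ - 1| ≤ C * μ⁻¹) :
    ∃ C, ∀ μ : ℝ, 1 ≤ μ → |∏ k ∈ s, f k μ - 1| ≤ C * μ⁻¹ := by
  classical
  induction s using Finset.induction_on with
  | empty => exact ⟨0, by simp⟩
  | insert k s hk ih =>
    obtain ⟨C₁, h₁⟩ := hf k (Finset.mem_insert_self k s)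
    obtain ⟨C₂, h₂⟩ := ih fun j hj => hf j (Finset.mem_insert_of_mem hj)
    refine ⟨C₁ * C₂ + C₁ + C₂, fun μ hμ => ?_⟩
    have hpos {C : ℝ} {x : ℝ} (h : |x| ≤ C * (1 : ℝ)⁻¹) : 0 ≤ C := by
      simpa using (abs_nonneg x).trans h
    have hC₁ := hpos (h₁ 1 le_rfl)
    have hC₂ := hpos (h₂ 1 le_rfl)
    rw [Finset.prod_insert hk]
    set u := f k μ
    set v := ∏ j ∈ s, f j μ
    have hu := h₁ μ hμ
    have hv := h₂ μ hμ
    have hμ0 : 0 < μ := by linarith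
    have hinv : μ⁻¹ ≤ 1 := inv_le_one_of_one_le₀ hμ
    calc |u * v - 1| = |(u - 1) * (v - 1) + (u - 1) + (v - 1)| := by ring_nf
      _ ≤ |u - 1| * |v - 1| + |u - 1| + |v - 1| := by
        rw [← abs_mul]; exact abs_add_three _ _ _
      _ ≤ (C₁ * μ⁻¹) * (C₂ * 1) + C₁ * μ⁻¹ + C₂ * μ⁻¹ := by
        gcongr
        exact hv.trans (by gcongr)
      _ = _ := by ring

lemma sum_Icc_one_cast (N : ℕ) :
    ∑ k ∈ Finset.Icc 1 N, (k : ℝ) = (N : ℝ) * (N + 1) / 2 := by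
  induction N with
  | zero => simp
  | succ N ih =>
    rw [Finset.sum_Icc_succ_top (by omega), ih]
    push_cast
    ring

open MeasureTheory Real

/-- Asymptotic expansion, as `r → ∞`, of the hole probability
`∏_{k=1}^N p_k(r)` of the generalised induced finite-`N` complex Ginibre ensemble,
where `p_k(r)` is the probability that a product of `n` independent Gamma variables
with shapes `k+m_1, …, k+m_n` and rate `1` exceeds `r²`. -/
theorem hole_probability_finite_N_asymptotics
    (n N : ℕ) (hn : 1 ≤ n) (hN : 1 ≤ N) (m : Fin n → ℝ) (hm : ∀ a, 0 ≤ m a)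
    (p : ℕ → ℝ → ℝ)
    (hp : ∀ (k : ℕ) (r : ℝ), p k r =
      ∫ x : Fin n → ℝ in {x | (∀ a, 0 < x a) ∧ r ^ 2 < ∏ a, x a},
        ∏ a, x a ^ ((k : ℝ) + m a - 1) * Real.exp (-x a) / Real.Gamma ((k : ℝ) + m a)) :
    ∃ C > 0, ∃ R₀ > 0, ∀ r ≥ R₀,
      |(∏ k ∈ Finset.Icc 1 N, p k r) /
          ((2 * π) ^ (((N * (n - 1) : ℕ) : ℝ) / 2) /
              ((n : ℝ) ^ ((N : ℝ) / 2) *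
                ∏ k ∈ Finset.Icc 1 N, ∏ a, Real.Gamma ((k : ℝ) + m a)) *
            Real.exp (-(n : ℝ) * N * r ^ ((2 : ℝ) / n) +
              (N : ℝ) * ((N : ℝ) + (2 * (∑ a, m a) - 1) / n) * Real.log r)) - 1|
        ≤ C * r ^ (-(2 : ℝ) / n) := by
  obtain ⟨n, rfl⟩ : ∃ j, n = j + 1 := ⟨n - 1, by omega⟩
  set ν : ℝ := ((n + 1 : ℕ) : ℝ) with hν
  have hν0 : 0 < ν := by rw [hν]; positivity
  set α : ℕ → Fin (n + 1) → ℝ := fun k a => (k : ℝ) + m a with hα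
  set s : ℕ → ℝ := fun k => ∑ a, α k a - ((n : ℝ) + 2) / 2 with hs
  set c : ℝ := (2 * π) ^ ((n : ℝ) / 2) / √ν with hc
  have hc0 : 0 < c := by positivity
  have hαpos : ∀ k ∈ Finset.Icc 1 N, ∀ a, 0 < α k a := by
    intro k hk a
    have h1 : (1 : ℝ) ≤ k := by exact_mod_cast (Finset.mem_Icc.1 hk).1
    have := hm a
    simp only [hα]
    linarith
  set L : ℕ → ℝ → ℝ := fun k μ => c * (exp (-(ν * μ)) * μ ^ s k) with hL
  obtain ⟨C, hC⟩ := exists_abs_prod_sub_one_le (Finset.Icc 1 N)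
    (fun k μ => gammaTail (α k) (μ ^ (n + 1)) / L k μ) (by
      intro k hk
      obtain ⟨C, hC⟩ := exists_abs_gammaTail_sub_le n (hαpos k hk)
      refine ⟨C / c, fun μ hμ => ?_⟩
      have hμ0 : 0 < μ := by linarith
      have hLpos : 0 < L k μ := by simp only [hL]; positivity
      rw [div_sub_one hLpos.ne', abs_div, abs_of_pos hLpos, div_le_iff₀ hLpos]
      refine (hC μ hμ).trans_eq ?_
      change C * (exp (-(ν * μ)) * μ ^ (s k - 1)) = _
      rw [rpow_sub_one hμ0.ne']
      simp only [hL]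
      field_simp)
  refine ⟨|C| + 1, by positivity, 1, one_pos, fun r hr => ?_⟩
  have hr0 : 0 < r := by linarith
  set μ := r ^ ((2 : ℝ) / ν) with hμ
  have hμ1 : 1 ≤ μ := one_le_rpow hr (by positivity)
  have hμ0 : 0 < μ := by linarith
  have hμinv : r ^ (-(2 : ℝ) / ν) = μ⁻¹ := by rw [hμ, ← rpow_neg hr0.le, neg_div]
  have hμpow : μ ^ (n + 1) = r ^ 2 := by
    rw [hμ, ← rpow_natCast, ← hν, ← rpow_mul hr0.le, div_mul_cancel₀ _ hν0.ne']
    norm_cast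
  have hpk (k : ℕ) : p k r = gammaTail (α k) (μ ^ (n + 1)) / ∏ a, Gamma (α k a) := by
    rw [hp, hμpow]
    exact setIntegral_prod_gamma_eq (α k) (r ^ 2)
  have hL_exp (k : ℕ) : L k μ = c * exp (-(ν * μ) + 2 / ν * s k * log r) := by
    simp only [hL]
    rw [exp_add, hμ, ← rpow_mul hr0.le, rpow_def_of_pos hr0 (2 / ν * s k), mul_comm (log r)]
  have hsum : ∑ k ∈ Finset.Icc 1 N, s k =
      ν * (N * (N + 1) / 2) + N * ∑ a, m a - N * (ν + 1) / 2 := by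
    simp only [hs, hα, Finset.sum_sub_distrib, Finset.sum_add_distrib, Finset.sum_const,
      Finset.card_univ, Fintype.card_fin, nsmul_eq_mul, Nat.card_Icc, ← Finset.mul_sum,
      sum_Icc_one_cast, Nat.add_sub_cancel]
    rw [hν]
    push_cast
    ring
  have hprodL : ∏ k ∈ Finset.Icc 1 N, L k μ =
      (2 * π) ^ (((N * n : ℕ) : ℝ) / 2) / ν ^ ((N : ℝ) / 2) *
        exp (-ν * N * μ + (N : ℝ) * ((N : ℝ) + (2 * (∑ a, m a) - 1) / ν) * log r) := by
    have hconst : c ^ N = (2 * π) ^ (((N * n : ℕ) : ℝ) / 2) / ν ^ ((N : ℝ) / 2) := by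
      rw [hc, div_pow, sqrt_eq_rpow, ← rpow_mul_natCast (by positivity),
        ← rpow_mul_natCast hν0.le]
      push_cast
      ring_nf
    simp only [hL_exp]
    rw [Finset.prod_mul_distrib, ← exp_sum, Finset.prod_const, Nat.card_Icc, Nat.add_sub_cancel,
      Finset.sum_add_distrib, ← Finset.sum_mul, ← Finset.mul_sum, hsum, Finset.sum_const,
      Nat.card_Icc, Nat.add_sub_cancel, nsmul_eq_mul, hconst]
    congr 2
    field_simp
    ring
  have hfinal : (∏ k ∈ Finset.Icc 1 N, p k r) /
      ((2 * π) ^ (((N * (n + 1 - 1) : ℕ) : ℝ) / 2) /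
          (ν ^ ((N : ℝ) / 2) * ∏ k ∈ Finset.Icc 1 N, ∏ a, Gamma ((k : ℝ) + m a)) *
        exp (-ν * N * μ + (N : ℝ) * ((N : ℝ) + (2 * (∑ a, m a) - 1) / ν) * log r)) =
      ∏ k ∈ Finset.Icc 1 N, gammaTail (α k) (μ ^ (n + 1)) / L k μ := by
    have hG : ∏ k ∈ Finset.Icc 1 N, ∏ a, Gamma (α k a) ≠ 0 :=
      Finset.prod_ne_zero_iff.2 fun k hk => Finset.prod_ne_zero_iff.2 fun a _ =>
        (Gamma_pos_of_pos (hαpos k hk a)).ne'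
    rw [Finset.prod_div_distrib, hprodL, Nat.add_sub_cancel]
    simp only [hpk, Finset.prod_div_distrib]
    change _ / (_ / (_ * ∏ k ∈ Finset.Icc 1 N, ∏ a, Gamma (α k a)) * _) = _
    field_simp
  rw [hfinal, hμinv]
  refine (hC μ hμ1).trans ?_
  gcongr
  linarith [le_abs_self C]
end

section
/- There exist constants C > 0 and R₀ > 1 such that for all r ≥ R₀, the infinite product ∏_{k=1}^∞ p_k(r) satisfies ∏_{k=1}^∞ p_k(r) ≤ exp( −(n/4) r^{4/n} + n (m_1 + ⋯ + m_n) r^{2/n} + C log r ). (Upper bound for the hole probability of the generalised induced infinite complex Ginibre ensemble.) -/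
open MeasureTheory Real

lemma measurableSet_setOf_pos_and_lt_prod {n : ℕ} (r : ℝ) :
    MeasurableSet {x : Fin n → ℝ | (∀ a, 0 < x a) ∧ r ^ 2 < ∏ a, x a} := by
  measurability

/-- Markov's inequality for the `s`-th moment of a product of independent Gamma variables. -/
lemma gamma_product_tail_le {n : ℕ} (c : Fin n → ℝ) (hc : ∀ a, 0 < c a) {r : ℝ} (hr : 0 < r)
    (s : ℕ) :
    ∫ x : Fin n → ℝ in {x | (∀ a, 0 < x a) ∧ r ^ 2 < ∏ a, x a},
        ∏ a, x a ^ (c a - 1) * Real.exp (-x a) / Real.Gamma (c a)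
      ≤ (∏ a, Real.Gamma (c a + s) / Real.Gamma (c a)) / (r ^ 2) ^ s := by
  have hS := measurableSet_setOf_pos_and_lt_prod (n := n) r
  set g : Fin n → ℝ → ℝ := fun a ↦ (Set.Ioi (0 : ℝ)).indicator
    fun t ↦ Real.exp (-t) * t ^ (c a + s - 1) / Real.Gamma (c a) with hg
  have hcs : ∀ a, 0 < c a + s := fun a ↦ by have := hc a; positivity
  have hgi : ∀ a, Integrable (g a) := fun a ↦
    (integrable_indicator_iff measurableSet_Ioi).2
      ((Real.GammaIntegral_convergent (hcs a)).div_const _)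
  have hgint : ∀ a, ∫ t, g a t = Real.Gamma (c a + s) / Real.Gamma (c a) := fun a ↦ by
    rw [hg]
    simp only
    rw [integral_indicator measurableSet_Ioi, integral_div, Real.Gamma_eq_integral (hcs a)]
  have hg0 : ∀ a t, 0 ≤ g a t := fun a t ↦ by
    refine Set.indicator_nonneg (fun t ht ↦ ?_) t
    have := Real.Gamma_pos_of_pos (hc a)
    have : 0 < t := ht
    positivity
  rw [← Finset.prod_congr rfl (fun a _ ↦ hgint a), ← integral_fintype_prod_volume_eq_prod,
    ← integral_div, ← integral_indicator hS]
  refine integral_mono_of_nonneg (Filter.Eventually.of_forall fun x ↦ ?_)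
    ((Integrable.fintype_prod hgi).div_const _) (Filter.Eventually.of_forall fun x ↦ ?_)
  · refine Set.indicator_nonneg (fun x hx ↦ Finset.prod_nonneg fun a _ ↦ ?_) x
    have := Real.Gamma_pos_of_pos (hc a)
    have := hx.1 a
    positivity
  · refine Set.indicator_apply_le' (fun hx ↦ ?_)
      (fun _ ↦ div_nonneg (Finset.prod_nonneg fun a _ ↦ hg0 a _) (by positivity))
    rw [le_div_iff₀ (by positivity)]
    calc _ ≤ (∏ a, x a ^ (c a - 1) * Real.exp (-x a) / Real.Gamma (c a)) * (∏ a, x a) ^ s := by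
          have h0 : 0 ≤ ∏ a, x a ^ (c a - 1) * Real.exp (-x a) / Real.Gamma (c a) :=
            Finset.prod_nonneg fun a _ ↦ by
              have := Real.Gamma_pos_of_pos (hc a)
              have := hx.1 a
              positivity
          have := hx.2.le
          gcongr
      _ = ∏ a, g a (x a) := by
          rw [← Finset.prod_pow, ← Finset.prod_mul_distrib]
          refine Finset.prod_congr rfl fun a _ ↦ ?_
          have hx := hx.1 a
          rw [hg]
          simp only
          rw [Set.indicator_of_mem (Set.mem_Ioi.2 hx), add_sub_right_comm, Real.rpow_add hx,
            Real.rpow_natCast]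
          ring

/-- An infinite product of factors in `[0, 1]` is at most each of its partial products. -/
lemma tprod_le_prod_range_of_mem_Icc {f : ℕ → ℝ} (h0 : ∀ k, 0 ≤ f k) (h1 : ∀ k, f k ≤ 1)
    (N : ℕ) : ∏' k, f k ≤ ∏ k ∈ Finset.range N, f k := by
  have hanti : Antitone fun s : Finset ℕ ↦ ∏ k ∈ s, f k :=
    Finset.prod_anti_set_of_le_one h0 h1
  have hbdd : BddBelow (Set.range fun s : Finset ℕ ↦ ∏ k ∈ s, f k) :=
    ⟨0, by rintro _ ⟨s, rfl⟩; exact Finset.prod_nonneg fun k _ ↦ h0 k⟩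
  have hprod : HasProd f (⨅ s : Finset ℕ, ∏ k ∈ s, f k) := tendsto_atTop_ciInf hanti hbdd
  rw [hprod.tprod_eq]
  exact ciInf_le hbdd _

/-- The midpoint inequality for the convex function `t ↦ t log t`, in terms of its primitive
`t ↦ t² / 2 * log t - t² / 4`. -/
lemma mul_log_le_primitive_sub {x : ℝ} (hx : 1 ≤ x) :
    x * log x ≤ ((x + 1 / 2) ^ 2 / 2 * log (x + 1 / 2) - (x + 1 / 2) ^ 2 / 4)
      - ((x - 1 / 2) ^ 2 / 2 * log (x - 1 / 2) - (x - 1 / 2) ^ 2 / 4) := by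
  have hx0 : 0 < x := by linarith
  obtain ⟨u, hu⟩ : ∃ u, u = 1 / (2 * x) := ⟨_, rfl⟩
  have hu0 : 0 < u := by rw [hu]; positivity
  have hxu : x * u = 1 / 2 := by rw [hu]; field_simp
  have hu1 : u ≤ 1 / 2 := by nlinarith
  have hp : log (x + 1 / 2) = log x + log (1 + u) := by
    rw [← log_mul hx0.ne' (by linarith)]; congr 1; linarith
  have hm : log (x - 1 / 2) = log x + log (1 - u) := by
    rw [← log_mul hx0.ne' (by linarith)]; congr 1; linarith
  have hsub : 2 * u + 2 / 3 * u ^ 3 ≤ log (1 + u) - log (1 - u) := by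
    have h := Real.hasSum_log_sub_log_of_abs_lt_one
      (show |u| < 1 by rw [abs_lt]; constructor <;> linarith)
    have h2 := sum_le_hasSum (Finset.range 2) (fun i _ ↦ by positivity) h
    norm_num [Finset.sum_range_succ] at h2
    linarith
  have hadd : -(4 / 3 * u ^ 2) ≤ log (1 + u) + log (1 - u) := by
    rw [← log_mul (by linarith) (by linarith)]
    have hpos : 0 < (1 + u) * (1 - u) := by nlinarith
    have h := Real.one_sub_inv_le_log_of_pos hpos
    refine le_trans ?_ h
    have : ((1 + u) * (1 - u))⁻¹ ≤ 1 + 4 / 3 * u ^ 2 := by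
      rw [inv_le_iff_one_le_mul₀ hpos]
      nlinarith [mul_nonneg (sq_nonneg u) (by nlinarith : (0 : ℝ) ≤ 1 / 4 - u ^ 2)]
    linarith
  have key : 2 * u ≤ (1 + u) ^ 2 * log (1 + u) - (1 - u) ^ 2 * log (1 - u) := by
    have h1 := mul_le_mul_of_nonneg_left hsub (by positivity : 0 ≤ 1 + u ^ 2)
    have h2 := mul_le_mul_of_nonneg_left hadd (by positivity : 0 ≤ 2 * u)
    have h3 : 0 ≤ u ^ 5 := by positivity
    nlinarith
  have key' := mul_le_mul_of_nonneg_left key (by positivity : 0 ≤ x ^ 2 / 2)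
  have e1 : x ^ 2 / 2 * (2 * u) = x / 2 := by linear_combination x * hxu
  have e2 : x ^ 2 / 2 * ((1 + u) ^ 2 * log (1 + u) - (1 - u) ^ 2 * log (1 - u))
      = (x + 1 / 2) ^ 2 / 2 * log (1 + u) - (x - 1 / 2) ^ 2 / 2 * log (1 - u) := by
    rw [← hxu]; ring
  rw [hp, hm]
  linarith

/-- A Stirling-type upper bound for `∑_{k ≤ N} log (Γ(N + m) / Γ(k + m))`. -/
lemma sum_log_Gamma_sub_le {m : ℝ} (hm : 0 ≤ m) {N : ℕ} (hN : 1 ≤ N) :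
    ∑ i ∈ Finset.range N, (log (Real.Gamma (N + m)) - log (Real.Gamma ((i + 1 : ℕ) + m)))
      ≤ ((N - 1 / 2 : ℝ) ^ 2 / 2 * log (N - 1 / 2) - (N - 1 / 2 : ℝ) ^ 2 / 4) + m * N + 1 := by
  induction N, hN using Nat.le_induction with
  | base =>
    have h2 := Real.log_two_lt_d9
    have : log (1 / 2) = -log 2 := by simp
    norm_num at this ⊢
    rw [this]
    linarith
  | succ N hN ih =>
    have hN1 : (1 : ℝ) ≤ N := by exact_mod_cast hN
    have hΓ : log (Real.Gamma ((N + 1 : ℕ) + m)) = log (N + m) + log (Real.Gamma (N + m)) := by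
      rw [← log_mul (by positivity) (Real.Gamma_pos_of_pos (by positivity)).ne',
        ← Real.Gamma_add_one (by positivity)]
      push_cast
      congr 2
      ring
    have hlog : N * log (N + m) ≤ N * log N + m := by
      have h := Real.log_le_sub_one_of_pos (show 0 < (N + m) / N by positivity)
      rw [log_div (by positivity) (by positivity)] at h
      have h' := mul_le_mul_of_nonneg_left h (by positivity : (0 : ℝ) ≤ N)
      have e : (N : ℝ) * ((N + m) / N - 1) = m := by field_simp; ring
      linarith
    have hmid := mul_log_le_primitive_sub hN1
    have e : ((N + 1 : ℕ) : ℝ) - 1 / 2 = N + 1 / 2 := by push_cast; ring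
    rw [Finset.sum_range_succ, sub_self, add_zero, e]
    rw [Finset.sum_sub_distrib] at ih ⊢
    simp only [Finset.sum_const, Finset.card_range, nsmul_eq_mul] at ih ⊢
    rw [hΓ]
    push_cast at ih ⊢
    linarith

/-- Comparison of the primitive of `t ↦ t log (t / R)` at `N - 1/2` with its value at `R`, when
`N = ⌊R⌋`. -/
lemma primitive_le_of_floor {R N : ℝ} (hN : 1 ≤ N) (hNR : N ≤ R) (hRN : R < N + 1) :
    ((N - 1 / 2) ^ 2 / 2 * log (N - 1 / 2) - (N - 1 / 2) ^ 2 / 4) - N * (N - 1) / 2 * log R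
      ≤ -(R ^ 2 / 4) + 2 + log R / 8 := by
  have hR : 0 < R := by linarith
  have ht : 0 < N - 1 / 2 := by linarith
  obtain ⟨t, hte⟩ : ∃ t, t = N - 1 / 2 := ⟨_, rfl⟩
  have hNt : N = t + 1 / 2 := by linarith
  rw [← hte] at ht ⊢
  have h := Real.log_le_sub_one_of_pos (show 0 < t / R by positivity)
  rw [log_div (by positivity) (by positivity)] at h
  have h' := mul_le_mul_of_nonneg_left h (by positivity : 0 ≤ t ^ 2 / 2)
  obtain ⟨d, hd⟩ : ∃ d, d = R - t := ⟨_, rfl⟩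
  have hd0 : 0 ≤ d := by linarith
  have hd1 : d ≤ 3 / 2 := by linarith
  have e : t ^ 2 / 2 * (t / R - 1) = -(R * d / 2) + d ^ 2 - d ^ 3 / (2 * R) := by
    rw [hd]; field_simp; ring
  have h3 : 0 ≤ d ^ 3 / (2 * R) := by positivity
  have e' : t ^ 2 = R ^ 2 - 2 * R * d + d ^ 2 := by rw [hd]; ring
  have hd2 : d ^ 2 ≤ 9 / 4 := by nlinarith
  have e'' : N * (N - 1) / 2 * log R = t ^ 2 / 2 * log R - log R / 8 := by rw [hNt]; ring
  rw [e'']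
  linarith

/-- Upper bound for the hole probability of the generalised induced infinite complex
Ginibre ensemble: `∏_{k=1}^∞ p_k(r) ≤ exp(-(n/4) r^{4/n} + n(m_1+⋯+m_n) r^{2/n} + O(log r))`. -/
theorem hole_probability_infinite_upper_bound
    (n : ℕ) (hn : 1 ≤ n) (m : Fin n → ℝ) (hm : ∀ a, 0 ≤ m a)
    (p : ℕ → ℝ → ℝ)
    (hp : ∀ (k : ℕ) (r : ℝ), p k r =
      ∫ x : Fin n → ℝ in {x | (∀ a, 0 < x a) ∧ r ^ 2 < ∏ a, x a},
        ∏ a, x a ^ ((k : ℝ) + m a - 1) * Real.exp (-x a) / Real.Gamma ((k : ℝ) + m a)) :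
    ∃ C > 0, ∃ R₀ > 1, ∀ r ≥ R₀,
      (∏' k : ℕ, p (k + 1) r) ≤
        Real.exp (-((n : ℝ) / 4) * r ^ ((4 : ℝ) / n)
          + (n : ℝ) * (∑ a, m a) * r ^ ((2 : ℝ) / n) + C * Real.log r) := by
  refine ⟨3 * n + 1, by positivity, Real.exp 1, by simp, fun r hr ↦ ?_⟩
  have hr0 : 0 < r := (Real.exp_pos 1).trans_le hr
  have hlogr : 1 ≤ log r := (Real.le_log_iff_exp_le hr0).2 hr
  have hn1 : (1 : ℝ) ≤ n := by exact_mod_cast hn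
  have hc : ∀ (k : ℕ) (a : Fin n), 0 < ((k + 1 : ℕ) : ℝ) + m a := fun k a ↦ by
    have := hm a
    positivity
  have hΓ : ∀ (k : ℕ) (a : Fin n), 0 < Real.Gamma (((k + 1 : ℕ) : ℝ) + m a) := fun k a ↦
    Real.Gamma_pos_of_pos (hc k a)
  have hp_le : ∀ k s : ℕ, p (k + 1) r ≤ (∏ a, Real.Gamma (((k + 1 : ℕ) : ℝ) + m a + s) /
      Real.Gamma (((k + 1 : ℕ) : ℝ) + m a)) / (r ^ 2) ^ s := fun k s ↦ by
    rw [hp]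
    exact gamma_product_tail_le _ (hc k) hr0 s
  have hp0 : ∀ k, 0 ≤ p (k + 1) r := fun k ↦ by
    rw [hp]
    refine integral_nonneg_of_ae ?_
    refine (ae_restrict_iff' ?_).2 (Filter.Eventually.of_forall fun x hx ↦ ?_)
    · exact measurableSet_setOf_pos_and_lt_prod r
    · refine Finset.prod_nonneg fun a _ ↦ ?_
      have := hΓ k a
      have := hx.1 a
      positivity
  have hp1 : ∀ k, p (k + 1) r ≤ 1 := fun k ↦ by
    refine (hp_le k 0).trans_eq ?_
    simp only [CharP.cast_eq_zero, add_zero, pow_zero, div_one]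
    exact Finset.prod_eq_one fun a _ ↦ div_self (hΓ k a).ne'
  obtain ⟨R, hR⟩ : ∃ R, R = r ^ ((2 : ℝ) / n) := ⟨_, rfl⟩
  have hlogR : n * log R = 2 * log r := by
    rw [hR, log_rpow hr0]
    field_simp
  have hR1 : 1 ≤ R := by
    rw [hR]
    exact Real.one_le_rpow (by linarith [Real.add_one_le_exp 1]) (by positivity)
  have hR2 : r ^ ((4 : ℝ) / n) = R ^ 2 := by
    rw [hR, ← Real.rpow_mul_natCast hr0.le]
    congr 1
    push_cast
    ring
  obtain ⟨N, hN⟩ : ∃ N, N = ⌊R⌋₊ := ⟨_, rfl⟩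
  have hN1 : 1 ≤ N := by rw [hN]; exact (Nat.one_le_floor_iff R).2 hR1
  have hNR : (N : ℝ) ≤ R := by rw [hN]; exact Nat.floor_le (by linarith)
  have hRN : R < N + 1 := by rw [hN]; exact Nat.lt_floor_add_one R
  have hterm : ∀ i ∈ Finset.range N, p (i + 1) r ≤ Real.exp
      (∑ a, (log (Real.Gamma (N + m a)) - log (Real.Gamma ((i + 1 : ℕ) + m a)))
        - ((N : ℝ) - 1 - i) * (2 * log r)) := fun i hi ↦ by
    obtain ⟨s, hs⟩ := Nat.exists_eq_add_of_lt (Finset.mem_range.1 hi)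
    refine (hp_le i s).trans_eq ?_
    rw [Real.exp_sub, Real.exp_sum]
    congr 1
    · refine Finset.prod_congr rfl fun a _ ↦ ?_
      have hNa : 0 < Real.Gamma (N + m a) :=
        Real.Gamma_pos_of_pos (add_pos_of_pos_of_nonneg (by positivity) (hm a))
      rw [Real.exp_sub, exp_log hNa, exp_log (hΓ i a)]
      congr 2
      rw [hs]
      push_cast
      ring
    · have e : ((N : ℝ) - 1 - i) * (2 * log r) = s * (2 * log r) := by
        rw [hs]
        push_cast
        ring
      rw [e, Real.exp_nat_mul, two_mul, Real.exp_add, exp_log hr0, sq]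
  have hsum : ∑ i ∈ Finset.range N, ((N : ℝ) - 1 - i) = N * (N - 1) / 2 := by
    have h : ∀ M : ℕ, ∑ i ∈ Finset.range M, (i : ℝ) = M * (M - 1) / 2 := fun M ↦ by
      induction M with
      | zero => simp
      | succ M ih => rw [Finset.sum_range_succ, ih]; push_cast; ring
    rw [Finset.sum_sub_distrib, h]
    simp
    ring
  calc _ ≤ ∏ k ∈ Finset.range N, p (k + 1) r := tprod_le_prod_range_of_mem_Icc hp0 hp1 N
    _ ≤ _ := Finset.prod_le_prod (fun i _ ↦ hp0 i) hterm
    _ ≤ _ := by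
      rw [← Real.exp_sum, Real.exp_le_exp, Finset.sum_sub_distrib, Finset.sum_comm,
        ← Finset.sum_mul, hsum, ← hlogR, hR2, ← hR]
      have h1 := Finset.sum_le_sum fun a (_ : a ∈ Finset.univ) ↦
        sum_log_Gamma_sub_le (hm a) hN1
      simp only [Finset.sum_add_distrib, Finset.sum_const, Finset.card_univ, Fintype.card_fin,
        nsmul_eq_mul, ← Finset.sum_mul] at h1
      have h2 := mul_le_mul_of_nonneg_left
        (primitive_le_of_floor (by exact_mod_cast hN1 : (1 : ℝ) ≤ N) hNR hRN)
        (by positivity : (0 : ℝ) ≤ n)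
      have hM : 0 ≤ ∑ a, m a := Finset.sum_nonneg fun a _ ↦ hm a
      have h3 : (∑ a, m a) * N ≤ (∑ a, m a) * R := by gcongr
      have h4 : (∑ a, m a) * R ≤ n * ((∑ a, m a) * R) :=
        le_mul_of_one_le_left (by positivity) hn1
      have h5 : (n : ℝ) ≤ n * log r := le_mul_of_one_le_right (by positivity) hlogr
      linarith
end

section
/- Suppose m_1, …, m_n are nonnegative integers. Then lim_{r→∞} (1/r^{4/n}) log( ∏_{k=1}^∞ p_k(r) ) = −n/4. In particular the leading-order decay of the hole probability of the generalised induced infinite complex Ginibre ensemble depends only on the number n of matrices multiplied and not on the parameters m_1, …, m_n. -/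
open MeasureTheory Real Filter

open scoped Nat

/-- The density on `(0, ∞)` of the Gamma distribution of shape `K + 1` and rate `1`. -/
noncomputable def gammaDensity (K : ℕ) (t : ℝ) : ℝ := t ^ K * exp (-t) / K !

/-- The probability that a Gamma variable of shape `K + 1` and rate `1` exceeds `R`. -/
noncomputable def gammaSurvival (K : ℕ) (R : ℝ) : ℝ :=
  exp (-R) * ∑ j ∈ Finset.range (K + 1), R ^ j / j !

lemma integrableOn_gammaDensity (K : ℕ) : IntegrableOn (gammaDensity K) (Set.Ioi 0) := by
  have h := Real.GammaIntegral_convergent (s := (K : ℝ) + 1) (by positivity)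
  refine IntegrableOn.congr_fun (h.div_const (K ! : ℝ)) (fun t _ => ?_) measurableSet_Ioi
  simp [gammaDensity, mul_comm]

lemma integral_gammaDensity_mul_pow (K s : ℕ) :
    ∫ t in Set.Ioi (0 : ℝ), gammaDensity K t * t ^ s = (K + s)! / K ! := by
  have h := Real.Gamma_eq_integral (s := ((K + s : ℕ) : ℝ) + 1) (by positivity)
  rw [Real.Gamma_nat_eq_factorial] at h
  rw [h, ← integral_div]
  refine setIntegral_congr_fun measurableSet_Ioi fun t _ => ?_
  simp only [add_sub_cancel_right, rpow_natCast, gammaDensity, pow_add]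
  ring

lemma integrableOn_gammaDensity_mul_pow (K s : ℕ) :
    IntegrableOn (fun t => gammaDensity K t * t ^ s) (Set.Ioi 0) := by
  refine IntegrableOn.congr_fun
    ((integrableOn_gammaDensity (K + s)).mul_const ((K + s)! / K ! : ℝ))
    (fun t _ => ?_) measurableSet_Ioi
  have h1 : (K ! : ℝ) ≠ 0 := by positivity
  have h2 : ((K + s)! : ℝ) ≠ 0 := by positivity
  simp only [gammaDensity, pow_add]
  field_simp

lemma gammaDensity_nonneg (K : ℕ) {t : ℝ} (ht : 0 ≤ t) : 0 ≤ gammaDensity K t := by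
  unfold gammaDensity
  positivity

lemma hasDerivAt_gammaSurvival (K : ℕ) (t : ℝ) :
    HasDerivAt (gammaSurvival K) (-gammaDensity K t) t := by
  have he : HasDerivAt (fun t : ℝ => exp (-t)) (-exp (-t)) t := by
    simpa using (hasDerivAt_neg t).exp
  induction K with
  | zero =>
    have hfun : gammaSurvival 0 = fun t => exp (-t) := by ext t; simp [gammaSurvival]
    simpa [hfun, gammaDensity] using he
  | succ K ih =>
    have hp := he.mul ((hasDerivAt_pow (K + 1) t).div_const ((K + 1)! : ℝ))
    have hsum := ih.add hp
    have hfun : gammaSurvival (K + 1) =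
        gammaSurvival K + (fun t => exp (-t)) * fun t => t ^ (K + 1) / ((K + 1)! : ℝ) := by
      ext t
      simp [gammaSurvival, Finset.sum_range_succ _ (K + 1), mul_add]
    rw [hfun]
    refine hsum.congr_deriv ?_
    have h1 : (K ! : ℝ) ≠ 0 := by positivity
    simp only [gammaDensity, Nat.factorial_succ]
    push_cast
    field_simp
    ring

lemma tendsto_gammaSurvival (K : ℕ) : Tendsto (gammaSurvival K) atTop (nhds 0) := by
  have h : ∀ j ∈ Finset.range (K + 1),
      Tendsto (fun t : ℝ => t ^ j * exp (-t) / j !) atTop (nhds 0) := fun j _ => by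
    simpa using (Real.tendsto_pow_mul_exp_neg_atTop_nhds_zero j).div_const (j ! : ℝ)
  have := tendsto_finsetSum _ h
  simp only [Finset.sum_const_zero] at this
  refine this.congr fun t => ?_
  simp only [gammaSurvival, Finset.mul_sum]
  exact Finset.sum_congr rfl fun j _ => by ring

lemma integral_Ioi_gammaDensity (K : ℕ) {R : ℝ} (hR : 0 ≤ R) :
    ∫ t in Set.Ioi R, gammaDensity K t = gammaSurvival K R := by
  have h := integral_Ioi_of_hasDerivAt_of_tendsto'
    (fun t (_ : t ∈ Set.Ici R) => (hasDerivAt_gammaSurvival K t).neg)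
    (((integrableOn_gammaDensity K).mono_set (Set.Ioi_subset_Ioi hR)).congr_fun
      (fun t _ => (neg_neg _).symm) measurableSet_Ioi)
    (tendsto_gammaSurvival K).neg
  simpa using h

section HoleProbability

variable {n : ℕ}

/-- The region of positive coordinates whose product exceeds `r ^ 2`. -/
def productExceeds (n : ℕ) (r : ℝ) : Set (Fin n → ℝ) :=
  {x | (∀ a, 0 < x a) ∧ r ^ 2 < ∏ a, x a}

lemma measurableSet_productExceeds (r : ℝ) : MeasurableSet (productExceeds n r) := by
  refine IsOpen.measurableSet ?_
  have : productExceeds n r = (⋂ a, {x | 0 < x a}) ∩ {x | r ^ 2 < ∏ a, x a} := by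
    ext x; simp [productExceeds]
  rw [this]
  refine (isOpen_iInter_of_finite fun a => ?_).inter ?_
  · exact isOpen_lt continuous_const (continuous_apply a)
  · exact isOpen_lt continuous_const (by fun_prop)

lemma prod_indicator_eq_indicator_pi (U : Set ℝ) (f : Fin n → ℝ → ℝ) (x : Fin n → ℝ) :
    ∏ a, U.indicator (f a) (x a) =
      (Set.univ.pi fun _ : Fin n => U).indicator (fun x => ∏ a, f a (x a)) x := by
  by_cases h : ∀ a, x a ∈ U
  · rw [Set.indicator_of_mem (by simpa [Set.mem_pi] using h)]
    exact Finset.prod_congr rfl fun a _ => Set.indicator_of_mem (h a) _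
  · rw [Set.indicator_of_notMem (by simpa [Set.mem_pi] using h)]
    push Not at h
    obtain ⟨a, ha⟩ := h
    exact Finset.prod_eq_zero (Finset.mem_univ a) (Set.indicator_of_notMem ha _)

lemma integral_prod_indicator {U : Set ℝ} (hU : MeasurableSet U) (f : Fin n → ℝ → ℝ) :
    ∫ x : Fin n → ℝ, ∏ a, U.indicator (f a) (x a) = ∏ a, ∫ t in U, f a t := by
  rw [integral_fintype_prod_volume_eq_prod]
  simp only [integral_indicator hU]

lemma integrable_prod_indicator {U : Set ℝ} (hU : MeasurableSet U) {f : Fin n → ℝ → ℝ}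
    (hf : ∀ a, IntegrableOn (f a) U) :
    Integrable fun x : Fin n → ℝ => ∏ a, U.indicator (f a) (x a) :=
  Integrable.fintype_prod fun a => (integrable_indicator_iff hU).2 (hf a)

/-- Markov's inequality for the `s`-th moment of a product of Gamma variables. -/
lemma integral_productExceeds_le (K : Fin n → ℕ) {r R : ℝ} (hR : 0 < R) (hRr : R ^ n = r ^ 2)
    (s : ℕ) :
    ∫ x in productExceeds n r, ∏ a, gammaDensity (K a) (x a) ≤
      ∏ a, ((K a + s)! / (K a)! / R ^ s : ℝ) := by
  have hmoment : ∏ a, ((K a + s)! / (K a)! / R ^ s : ℝ) =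
      ∫ x : Fin n → ℝ, ∏ a, (Set.Ioi (0 : ℝ)).indicator
        (fun t => gammaDensity (K a) t * t ^ s / R ^ s) (x a) := by
    rw [integral_prod_indicator measurableSet_Ioi]
    refine Finset.prod_congr rfl fun a _ => ?_
    rw [integral_div, integral_gammaDensity_mul_pow]
  rw [hmoment, ← integral_indicator (measurableSet_productExceeds r)]
  have hdens : ∀ x ∈ productExceeds n r, 0 ≤ ∏ a, gammaDensity (K a) (x a) := fun x hx =>
    Finset.prod_nonneg fun a _ => gammaDensity_nonneg _ (hx.1 a).le
  refine integral_mono_of_nonneg (ae_of_all _ fun x => Set.indicator_nonneg hdens x)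
    (integrable_prod_indicator measurableSet_Ioi fun a =>
      (integrableOn_gammaDensity_mul_pow _ s).div_const _) (ae_of_all _ fun x => ?_)
  by_cases hx : x ∈ productExceeds n r
  · rw [Set.indicator_of_mem hx]
    have hprod : ∏ a, (Set.Ioi (0 : ℝ)).indicator
        (fun t => gammaDensity (K a) t * t ^ s / R ^ s) (x a) =
        (∏ a, gammaDensity (K a) (x a)) * ((∏ a, x a) / R ^ n) ^ s := by
      rw [Finset.prod_congr rfl fun a _ =>
        Set.indicator_of_mem (s := Set.Ioi (0 : ℝ)) (hx.1 a) _, Finset.prod_div_distrib,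
        Finset.prod_mul_distrib, Finset.prod_pow, Finset.prod_const, Finset.card_univ,
        Fintype.card_fin, div_pow, ← pow_mul, ← pow_mul, mul_comm s n, mul_div_assoc]
    simp only [hprod]
    refine le_mul_of_one_le_right (hdens x hx) (one_le_pow₀ ?_)
    rw [one_le_div (by positivity), hRr]
    exact hx.2.le
  · rw [Set.indicator_of_notMem hx]
    exact Finset.prod_nonneg fun a _ => Set.indicator_nonneg (fun t (ht : 0 < t) =>
      div_nonneg (mul_nonneg (gammaDensity_nonneg _ ht.le) (by positivity)) (by positivity)) _

lemma prod_gammaSurvival_le_integral (hn : 1 ≤ n) (K : Fin n → ℕ) {r R : ℝ} (hR : 0 < R)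
    (hRr : R ^ n = r ^ 2) :
    ∏ a, gammaSurvival (K a) R ≤ ∫ x in productExceeds n r, ∏ a, gammaDensity (K a) (x a) := by
  have hsub : (Set.univ.pi fun _ : Fin n => Set.Ioi R) ⊆ productExceeds n r := fun x hx => by
    simp only [Set.mem_pi, Set.mem_univ, Set.mem_Ioi, forall_const] at hx
    refine ⟨fun a => hR.trans (hx a), ?_⟩
    have : Nonempty (Fin n) := ⟨⟨0, hn⟩⟩
    have := Finset.prod_lt_prod_of_nonempty (s := Finset.univ) (f := fun _ : Fin n => R) (g := x)
      (fun _ _ => hR) (fun a _ => hx a) Finset.univ_nonempty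
    simpa [hRr] using this
  have hpos : productExceeds n r ⊆ Set.univ.pi fun _ : Fin n => Set.Ioi (0 : ℝ) :=
    fun x hx a _ => hx.1 a
  have hint : IntegrableOn (fun x : Fin n → ℝ => ∏ a, gammaDensity (K a) (x a))
      (Set.univ.pi fun _ : Fin n => Set.Ioi (0 : ℝ)) := by
    rw [← integrable_indicator_iff (MeasurableSet.univ_pi fun _ => measurableSet_Ioi)]
    refine (integrable_prod_indicator measurableSet_Ioi fun a =>
      integrableOn_gammaDensity (K a)).congr (ae_of_all _ fun x => ?_)
    exact prod_indicator_eq_indicator_pi _ _ x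
  have heq : ∏ a, gammaSurvival (K a) R =
      ∫ x in (Set.univ.pi fun _ : Fin n => Set.Ioi R), ∏ a, gammaDensity (K a) (x a) := by
    rw [← integral_indicator (MeasurableSet.univ_pi fun _ => measurableSet_Ioi)]
    rw [integral_congr_ae (ae_of_all _ fun x =>
      (prod_indicator_eq_indicator_pi _ (fun a => gammaDensity (K a)) x).symm),
      integral_prod_indicator measurableSet_Ioi]
    simp only [integral_Ioi_gammaDensity _ hR.le]
  rw [heq]
  refine setIntegral_mono_set (hint.mono_set hpos) ?_ (LE.le.eventuallyLE hsub)
  exact (ae_restrict_iff' (measurableSet_productExceeds r)).2 (ae_of_all _ fun x hx =>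
    Finset.prod_nonneg fun a _ => gammaDensity_nonneg _ (hx.1 a).le)

end HoleProbability

lemma gammaSurvival_mono {K K' : ℕ} (h : K ≤ K') {R : ℝ} (hR : 0 ≤ R) :
    gammaSurvival K R ≤ gammaSurvival K' R := by
  unfold gammaSurvival
  gcongr

lemma gammaSurvival_term_le (K : ℕ) {R : ℝ} (hR : 0 ≤ R) :
    exp (-R) * (R ^ K / K !) ≤ gammaSurvival K R := by
  unfold gammaSurvival
  gcongr
  exact Finset.single_le_sum (f := fun j => R ^ j / (j ! : ℝ)) (fun j _ => by positivity)
    (Finset.self_mem_range_succ K)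

lemma gammaSurvival_pos (K : ℕ) {R : ℝ} (hR : 0 < R) : 0 < gammaSurvival K R :=
  lt_of_lt_of_le (by positivity) (gammaSurvival_term_le K hR.le)

lemma gammaSurvival_le_one (K : ℕ) {R : ℝ} (hR : 0 ≤ R) : gammaSurvival K R ≤ 1 := by
  rw [gammaSurvival, exp_neg, inv_mul_le_one₀ (exp_pos R)]
  exact Real.sum_le_exp_of_nonneg hR _

lemma sum_add_tsum_exp (R : ℝ) (k : ℕ) :
    ∑ j ∈ Finset.range k, R ^ j / (j ! : ℝ) + ∑' j : ℕ, R ^ (j + k) / ((j + k)! : ℝ) = exp R := by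
  rw [(Real.summable_pow_div_factorial R).sum_add_tsum_nat_add k, Real.exp_eq_exp_ℝ,
    NormedSpace.exp_eq_tsum_div]

lemma one_sub_gammaSurvival_le (K : ℕ) {R : ℝ} (hR : 0 ≤ R) :
    1 - gammaSurvival K R ≤ exp R / 2 ^ (K + 1) := by
  have h1 := sum_add_tsum_exp R (K + 1)
  have h2 := sum_add_tsum_exp (2 * R) (K + 1)
  have hs : 0 ≤ ∑ j ∈ Finset.range (K + 1), (2 * R) ^ j / (j ! : ℝ) :=
    Finset.sum_nonneg fun j _ => by positivity
  have htail : ∑' j : ℕ, R ^ (j + (K + 1)) / ((j + (K + 1))! : ℝ) ≤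
      (∑' j : ℕ, (2 * R) ^ (j + (K + 1)) / ((j + (K + 1))! : ℝ)) / 2 ^ (K + 1) := by
    rw [← tsum_div_const]
    refine Summable.tsum_le_tsum (fun j => ?_)
      ((summable_nat_add_iff (K + 1)).2 (Real.summable_pow_div_factorial R))
      (((summable_nat_add_iff (K + 1)).2 (Real.summable_pow_div_factorial (2 * R))).div_const _)
    have heq : (2 * R) ^ (j + (K + 1)) / ((j + (K + 1))! : ℝ) / 2 ^ (K + 1) =
        R ^ (j + (K + 1)) / ((j + (K + 1))! : ℝ) * 2 ^ j := by
      rw [mul_pow, pow_add 2 j]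
      field_simp
    rw [heq]
    exact le_mul_of_one_le_right (by positivity) (one_le_pow₀ (by norm_num))
  have hle : ∑' j : ℕ, R ^ (j + (K + 1)) / ((j + (K + 1))! : ℝ) ≤
      exp (2 * R) / 2 ^ (K + 1) := htail.trans (by gcongr; linarith)
  have hg : 1 - gammaSurvival K R =
      exp (-R) * ∑' j : ℕ, R ^ (j + (K + 1)) / ((j + (K + 1))! : ℝ) := by
    rw [gammaSurvival, eq_sub_of_add_eq h1, mul_sub, ← exp_add, neg_add_cancel, exp_zero,
      sub_sub_cancel]
  rw [hg]
  calc _ ≤ exp (-R) * (exp (2 * R) / 2 ^ (K + 1)) := by gcongr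
    _ = _ := by
      rw [← mul_div_assoc, ← exp_add]
      ring_nf

lemma neg_half_pow_le_log_gammaSurvival {R : ℝ} (hR : 0 < R) (i : ℕ) :
    -(1 / 2 : ℝ) ^ i ≤ log (gammaSurvival (i + 2 * ⌈R⌉₊) R) := by
  set g := gammaSurvival (i + 2 * ⌈R⌉₊) R
  have hg : 0 < g := gammaSurvival_pos _ hR
  have hexp : exp R ≤ 2 ^ (2 * ⌈R⌉₊) := by
    calc exp R ≤ exp (⌈R⌉₊ : ℝ) := exp_le_exp.2 (Nat.le_ceil R)
      _ = exp 1 ^ ⌈R⌉₊ := by rw [← exp_nat_mul, mul_one]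
      _ ≤ 4 ^ ⌈R⌉₊ := by
        gcongr
        exact exp_one_lt_d9.le.trans (by norm_num)
      _ = _ := by rw [pow_mul]; norm_num
  have hsub : 1 - g ≤ (1 / 2 : ℝ) ^ i / 2 := by
    refine (one_sub_gammaSurvival_le _ hR.le).trans ?_
    rw [div_le_iff₀ (by positivity), pow_succ, pow_add, one_div, inv_pow]
    field_simp
    exact hexp
  have hpow : (1 / 2 : ℝ) ^ i ≤ 1 := pow_le_one₀ (by norm_num) (by norm_num)
  refine le_trans ?_ (Real.one_sub_inv_le_log_of_pos hg)
  have hinv : 1 - g⁻¹ = -((1 - g) / g) := by field_simp; ring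
  rw [hinv, neg_le_neg_iff, div_le_iff₀ hg]
  have : (0 : ℝ) < (1 / 2) ^ i := by positivity
  nlinarith

lemma summable_log_gammaSurvival {R : ℝ} (hR : 0 < R) :
    Summable fun K => log (gammaSurvival K R) := by
  rw [← summable_nat_add_iff (2 * ⌈R⌉₊)]
  refine Summable.of_norm_bounded summable_geometric_two fun i => ?_
  rw [Real.norm_eq_abs, abs_of_nonpos (log_nonpos (gammaSurvival_pos _ hR).le
    (gammaSurvival_le_one _ hR.le))]
  exact neg_le.1 (neg_half_pow_le_log_gammaSurvival hR i)

lemma log_factorial_le {N : ℕ} (hN : 1 ≤ N) :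
    log (N ! : ℝ) ≤ 1 + log N + N * log N - N := by
  obtain ⟨M, rfl⟩ : ∃ M, N = M + 1 := ⟨N - 1, by omega⟩
  have h := Stirling.stirlingSeq'_antitone (Nat.zero_le M)
  have hpos : (0 : ℝ) < ((M + 1 : ℕ) : ℝ) := by positivity
  simp only [Function.comp_apply, Nat.succ_eq_add_one, zero_add, Stirling.stirlingSeq_one] at h
  have hlog := Real.log_le_log (Stirling.stirlingSeq'_pos M) h
  have h1 : (1 : ℝ) ≤ ((M + 1 : ℕ) : ℝ) := by exact_mod_cast hN
  have h0 := log_nonneg h1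
  rw [Stirling.log_stirlingSeq_formula, log_div (exp_pos 1).ne' (by positivity), log_exp,
    log_sqrt (by norm_num), log_div hpos.ne' (exp_pos 1).ne', log_exp,
    log_mul (by norm_num) hpos.ne'] at hlog
  linarith

lemma log_central_term_ge {R : ℝ} (hR : 1 ≤ R) :
    -(2 + log R) ≤ -R + ⌊R⌋₊ * log R - log (⌊R⌋₊ ! : ℝ) := by
  have hN : 1 ≤ ⌊R⌋₊ := Nat.one_le_floor_iff R |>.2 hR
  have hN' : (1 : ℝ) ≤ ⌊R⌋₊ := by exact_mod_cast hN
  have hle : (⌊R⌋₊ : ℝ) ≤ R := Nat.floor_le (by linarith)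
  have hlt := Nat.lt_floor_add_one R
  have hlog : log (⌊R⌋₊ : ℝ) ≤ log R := log_le_log (by linarith) hle
  have := log_factorial_le hN
  nlinarith

lemma log_factorial_add_sum {R : ℝ} (hR : 0 < R) (m : ℕ) {K N : ℕ} (h : K ≤ N) :
    log ((K + m)! : ℝ) + ∑ i ∈ Finset.Ico (K + 1) (N + 1), log (((i + m : ℕ) : ℝ) / R) =
      log ((N + m)! : ℝ) - ((N : ℝ) - K) * log R := by
  induction N, h using Nat.le_induction with
  | base => simp
  | succ N h ih =>
    rw [Finset.sum_Ico_succ_top (by omega), ← add_assoc, ih,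
      show N + 1 + m = (N + m) + 1 by ring, Nat.factorial_succ, Nat.cast_mul,
      log_mul (by positivity) (by positivity), log_div (by positivity) hR.ne']
    push_cast
    ring

lemma sum_sum_Ico (f : ℕ → ℝ) (N : ℕ) :
    ∑ K ∈ Finset.range (N + 1), ∑ i ∈ Finset.Ico (K + 1) (N + 1), f i =
      ∑ i ∈ Finset.range (N + 1), i * f i := by
  induction N with
  | zero => simp
  | succ N ih =>
    rw [Finset.sum_range_succ, Finset.sum_range_succ _ (N + 1), ← ih, Finset.Ico_self,
      Finset.sum_empty, add_zero, Finset.sum_congr rfl fun K hK =>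
        Finset.sum_Ico_succ_top (Nat.succ_le_succ (Finset.mem_range_succ_iff.1 hK)) f,
      Finset.sum_add_distrib]
    simp

/-- The sum `∑ i log (i / R)` over natural numbers `i ≤ R`. -/
noncomputable def weightedLogSum (R : ℝ) : ℝ :=
  ∑ i ∈ Finset.range (⌊R⌋₊ + 1), i * log (i / R)

lemma log_gammaSurvival_ge {R : ℝ} (hR : 1 ≤ R) (K : ℕ) :
    -(2 + log R) + ∑ i ∈ Finset.Ico (K + 1) (⌊R⌋₊ + 1), log (i / R) ≤
      log (gammaSurvival K R) := by
  have hR0 : 0 < R := by linarith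
  have hterm : ∀ K : ℕ, -R + K * log R - log (K ! : ℝ) ≤ log (gammaSurvival K R) := fun K => by
    refine le_trans (le_of_eq ?_) (log_le_log (by positivity) (gammaSurvival_term_le K hR0.le))
    rw [log_mul (by positivity) (by positivity), log_div (by positivity) (by positivity), log_exp,
      log_pow]
    ring
  have hc := log_central_term_ge hR
  rcases le_total K ⌊R⌋₊ with h | h
  · have := log_factorial_add_sum hR0 0 h
    simp only [add_zero] at this
    have := hterm K
    linarith
  · rw [Finset.Ico_eq_empty (by omega), Finset.sum_empty, add_zero]
    exact hc.trans ((hterm _).trans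
      (log_le_log (gammaSurvival_pos _ hR0) (gammaSurvival_mono h hR0.le)))

lemma tsum_log_gammaSurvival_ge {R : ℝ} (hR : 1 ≤ R) :
    weightedLogSum R - 4 * R * (2 + log R) - 2 ≤ ∑' K, log (gammaSurvival K R) := by
  have hR0 : 0 < R := by linarith
  set J := 2 * ⌈R⌉₊
  have hJN : ⌊R⌋₊ + 1 ≤ J := by
    have h1 : ⌊R⌋₊ ≤ ⌈R⌉₊ := Nat.floor_le_ceil R
    have h2 : 1 ≤ ⌈R⌉₊ := Nat.one_le_ceil_iff.2 hR0
    omega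
  have hJ : (J : ℝ) ≤ 4 * R := by
    have := Nat.ceil_lt_add_one hR0.le
    simp only [J]
    push_cast
    linarith
  rw [← (summable_log_gammaSurvival hR0).sum_add_tsum_nat_add J]
  have htail : -2 ≤ ∑' i, log (gammaSurvival (i + J) R) := by
    rw [← tsum_geometric_two, ← tsum_neg]
    exact Summable.tsum_le_tsum (neg_half_pow_le_log_gammaSurvival hR0)
      summable_geometric_two.neg
      ((summable_nat_add_iff (f := fun K => log (gammaSurvival K R)) J).2
        (summable_log_gammaSurvival hR0))
  have hhead := Finset.sum_le_sum fun K (_ : K ∈ Finset.range J) => log_gammaSurvival_ge hR K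
  have hW : ∑ K ∈ Finset.range J, ∑ i ∈ Finset.Ico (K + 1) (⌊R⌋₊ + 1), log (i / R) =
      weightedLogSum R := by
    rw [weightedLogSum, ← sum_sum_Ico]
    refine (Finset.sum_subset (Finset.range_mono hJN) fun K _ hK => ?_).symm
    rw [Finset.Ico_eq_empty (by simp at hK; omega), Finset.sum_empty]
  rw [Finset.sum_add_distrib, hW, Finset.sum_const, Finset.card_range, nsmul_eq_mul] at hhead
  have := log_nonneg hR
  nlinarith

lemma log_add_one_bounds {L : ℕ} (hL : 1 ≤ L) :
    log (L : ℝ) + 1 / (L + 1) ≤ log ((L : ℝ) + 1) ∧ log ((L : ℝ) + 1) ≤ log (L : ℝ) + 1 / L := by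
  have hL0 : (0 : ℝ) < L := by exact_mod_cast hL
  have h := log_div (x := (L : ℝ) + 1) (y := L) (by positivity) hL0.ne'
  have h1 := Real.one_sub_inv_le_log_of_pos (x := ((L : ℝ) + 1) / L) (by positivity)
  have h2 := Real.log_le_sub_one_of_pos (x := ((L : ℝ) + 1) / L) (by positivity)
  have e1 : 1 - (((L : ℝ) + 1) / L)⁻¹ = 1 / (L + 1) := by field_simp; ring
  have e2 : ((L : ℝ) + 1) / L - 1 = 1 / L := by field_simp; ring
  constructor <;> linarith

lemma sum_mul_log_bounds {L : ℕ} (hL : 1 ≤ L) :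
    (L : ℝ) ^ 2 / 2 * log L - (L : ℝ) ^ 2 / 4 ≤ ∑ i ∈ Finset.range (L + 1), (i : ℝ) * log i ∧
      ∑ i ∈ Finset.range (L + 1), (i : ℝ) * log i ≤
        (L : ℝ) ^ 2 / 2 * log L - (L : ℝ) ^ 2 / 4 + L * log L + 1 / 4 := by
  induction L, hL using Nat.le_induction with
  | base => norm_num [Finset.sum_range_succ]
  | succ L hL ih =>
    have hL1 : (1 : ℝ) ≤ L := by exact_mod_cast hL
    obtain ⟨h1, h2⟩ := log_add_one_bounds hL
    rw [Finset.sum_range_succ]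
    push_cast
    set a := log (L : ℝ)
    set b := log ((L : ℝ) + 1)
    have ha : 0 ≤ a := log_nonneg hL1
    have h3 : ((L : ℝ) + 1) * (b - a) ≥ 1 := by
      have : 1 / ((L : ℝ) + 1) ≤ b - a := by linarith
      rw [div_le_iff₀ (by positivity)] at this
      linarith
    have h4 : (L : ℝ) * (b - a) ≤ 1 := by
      have : b - a ≤ 1 / (L : ℝ) := by linarith
      rw [le_div_iff₀ (by positivity)] at this
      linarith
    constructor
    · nlinarith
    · nlinarith

lemma abs_weightedLogSum_add_le {R : ℝ} (hR : 1 ≤ R) :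
    |weightedLogSum R + R ^ 2 / 4| ≤ R * (1 + log R) := by
  have hR0 : 0 < R := by linarith
  have hN : 1 ≤ ⌊R⌋₊ := Nat.one_le_floor_iff R |>.2 hR
  have hle : (⌊R⌋₊ : ℝ) ≤ R := Nat.floor_le (by linarith)
  have hlt := Nat.lt_floor_add_one R
  have hW : weightedLogSum R = ∑ i ∈ Finset.range (⌊R⌋₊ + 1), (i : ℝ) * log i -
      ((⌊R⌋₊ : ℝ) ^ 2 + ⌊R⌋₊) / 2 * log R := by
    rw [weightedLogSum]
    generalize ⌊R⌋₊ = N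
    induction N with
    | zero => simp
    | succ N ih =>
      rw [Finset.sum_range_succ, ih, Finset.sum_range_succ _ (N + 1),
        log_div (by positivity) hR0.ne']
      push_cast
      ring
  obtain ⟨h1, h2⟩ := sum_mul_log_bounds hN
  have hN' : (1 : ℝ) ≤ ⌊R⌋₊ := by exact_mod_cast hN
  rw [hW]
  generalize (∑ i ∈ Finset.range (⌊R⌋₊ + 1), (i : ℝ) * log i) = S at *
  have hlogle : log (⌊R⌋₊ : ℝ) ≤ log R := log_le_log (by linarith) hle
  have hlog0 : 0 ≤ log (⌊R⌋₊ : ℝ) := log_nonneg hN'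
  have hdiff : (⌊R⌋₊ : ℝ) * (log R - log ⌊R⌋₊) ≤ 1 := by
    have h := Real.log_le_sub_one_of_pos (x := R / ⌊R⌋₊) (by positivity)
    rw [log_div hR0.ne' (by positivity)] at h
    calc _ ≤ (⌊R⌋₊ : ℝ) * (R / ⌊R⌋₊ - 1) := by gcongr
      _ = R - ⌊R⌋₊ := by field_simp
      _ ≤ 1 := by linarith
  generalize (⌊R⌋₊ : ℝ) = N at *
  generalize log N = a at *
  generalize log R = b at *
  rw [abs_le]
  constructor
  · have e1 : N * (N * (b - a)) ≤ N * 1 := by gcongr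
    have e2 : N ^ 2 ≤ R ^ 2 := by gcongr
    have e3 : N * b ≤ R * b := by gcongr; linarith
    have e4 : 0 ≤ R * b := by nlinarith
    nlinarith
  · have e1 : N ^ 2 * a ≤ N ^ 2 * b := by gcongr
    have e3 : N * b ≤ R * b := by gcongr; linarith
    have e5 : N * a ≤ N * b := by gcongr
    have e6 : R ^ 2 - 2 * R ≤ N ^ 2 - 1 := by nlinarith
    nlinarith

section HoleLog

variable {n : ℕ} {r R : ℝ}

/-- The hole probability factor with Gamma shapes `k + m a + 1`. -/
noncomputable def holeFactor (m : Fin n → ℕ) (r : ℝ) (k : ℕ) : ℝ :=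
  ∫ x in productExceeds n r, ∏ a, gammaDensity (k + m a) (x a)

lemma pow_gammaSurvival_le_holeFactor (hn : 1 ≤ n) (m : Fin n → ℕ) (hR : 0 < R)
    (hRr : R ^ n = r ^ 2) (k : ℕ) : gammaSurvival k R ^ n ≤ holeFactor m r k := by
  refine le_trans ?_ (prod_gammaSurvival_le_integral hn (fun a => k + m a) hR hRr)
  calc gammaSurvival k R ^ n = ∏ _a : Fin n, gammaSurvival k R := by simp
    _ ≤ _ := Finset.prod_le_prod (fun _ _ => (gammaSurvival_pos k hR).le)
      fun a _ => gammaSurvival_mono (Nat.le_add_right k (m a)) hR.le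

lemma holeFactor_pos (hn : 1 ≤ n) (m : Fin n → ℕ) (hR : 0 < R) (hRr : R ^ n = r ^ 2) (k : ℕ) :
    0 < holeFactor m r k :=
  (pow_pos (gammaSurvival_pos k hR) n).trans_le (pow_gammaSurvival_le_holeFactor hn m hR hRr k)

lemma log_holeFactor_ge (hn : 1 ≤ n) (m : Fin n → ℕ) (hR : 0 < R) (hRr : R ^ n = r ^ 2) (k : ℕ) :
    n * log (gammaSurvival k R) ≤ log (holeFactor m r k) := by
  rw [← log_pow]
  exact log_le_log (pow_pos (gammaSurvival_pos k hR) n)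
    (pow_gammaSurvival_le_holeFactor hn m hR hRr k)

lemma log_holeFactor_nonpos (hn : 1 ≤ n) (m : Fin n → ℕ) (hR : 0 < R) (hRr : R ^ n = r ^ 2)
    (k : ℕ) : log (holeFactor m r k) ≤ 0 := by
  refine log_nonpos (holeFactor_pos hn m hR hRr k).le ?_
  refine (integral_productExceeds_le (fun a => k + m a) hR hRr 0).trans_eq ?_
  exact Finset.prod_eq_one fun a _ => by
    simp [div_self (show ((k + m a)! : ℝ) ≠ 0 by positivity)]

lemma log_holeFactor_le (hn : 1 ≤ n) (m : Fin n → ℕ) (hR : 0 < R) (hRr : R ^ n = r ^ 2)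
    {k N : ℕ} (hk : k ≤ N) :
    log (holeFactor m r k) ≤
      ∑ i ∈ Finset.Ico (k + 1) (N + 1), ∑ a, log (((i + m a : ℕ) : ℝ) / R) := by
  refine (log_le_log (holeFactor_pos hn m hR hRr k)
    (integral_productExceeds_le (fun a => k + m a) hR hRr (N - k))).trans_eq ?_
  rw [log_prod fun a _ => by positivity, Finset.sum_comm]
  refine Finset.sum_congr rfl fun a _ => ?_
  have h := log_factorial_add_sum hR (m a) hk
  rw [log_div (by positivity) (by positivity), log_div (by positivity) (by positivity), log_pow,
    Nat.cast_sub hk, show k + m a + (N - k) = N + m a by omega]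
  linarith

lemma summable_log_holeFactor (hn : 1 ≤ n) (m : Fin n → ℕ) (hR : 0 < R) (hRr : R ^ n = r ^ 2) :
    Summable fun k => log (holeFactor m r k) := by
  refine Summable.of_norm_bounded ((summable_log_gammaSurvival hR).mul_left (n : ℝ)).neg
    fun k => ?_
  rw [Real.norm_eq_abs, abs_of_nonpos (log_holeFactor_nonpos hn m hR hRr k)]
  exact neg_le_neg (log_holeFactor_ge hn m hR hRr k)

lemma mul_log_add_div_le (hR : 0 < R) (i m : ℕ) :
    (i : ℝ) * log (((i + m : ℕ) : ℝ) / R) ≤ i * log (i / R) + m := by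
  rcases Nat.eq_zero_or_pos i with rfl | hi
  · simp
  have hi' : (0 : ℝ) < i := by exact_mod_cast hi
  have h := Real.log_le_sub_one_of_pos (x := ((i + m : ℕ) : ℝ) / i) (by positivity)
  rw [log_div (by positivity) hi'.ne'] at h
  rw [log_div (by positivity) hR.ne', log_div hi'.ne' hR.ne']
  have e : (i : ℝ) * (((i + m : ℕ) : ℝ) / i - 1) = m := by
    push_cast
    field_simp
    ring
  nlinarith [mul_le_mul_of_nonneg_left h hi'.le]

lemma tsum_log_holeFactor_le (hn : 1 ≤ n) (m : Fin n → ℕ) (hR : 1 ≤ R) (hRr : R ^ n = r ^ 2) :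
    ∑' k, log (holeFactor m r k) ≤ n * weightedLogSum R + 2 * R * ∑ a, (m a : ℝ) := by
  have hR0 : 0 < R := by linarith
  set N := ⌊R⌋₊
  have hN : (N : ℝ) ≤ R := Nat.floor_le hR0.le
  have hhead : ∑' k, log (holeFactor m r k) ≤
      ∑ k ∈ Finset.range (N + 1), log (holeFactor m r k) := by
    have h := Summable.sum_le_tsum (Finset.range (N + 1))
      (fun k _ => neg_nonneg.2 (log_holeFactor_nonpos hn m hR0 hRr k))
      (summable_log_holeFactor hn m hR0 hRr).neg
    rw [tsum_neg, Finset.sum_neg_distrib] at h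
    exact neg_le_neg_iff.1 h
  calc _ ≤ _ := hhead
    _ ≤ ∑ k ∈ Finset.range (N + 1), ∑ i ∈ Finset.Ico (k + 1) (N + 1),
        ∑ a, log (((i + m a : ℕ) : ℝ) / R) := Finset.sum_le_sum fun k hk =>
      log_holeFactor_le hn m hR0 hRr (Finset.mem_range_succ_iff.1 hk)
    _ = ∑ i ∈ Finset.range (N + 1), ∑ a, i * log (((i + m a : ℕ) : ℝ) / R) := by
      simp only [sum_sum_Ico (fun i => ∑ a, log (((i + m a : ℕ) : ℝ) / R)), Finset.mul_sum]
    _ ≤ ∑ i ∈ Finset.range (N + 1), ∑ a, (i * log (i / R) + m a) :=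
      Finset.sum_le_sum fun i _ => Finset.sum_le_sum fun a _ => mul_log_add_div_le hR0 i (m a)
    _ = n * weightedLogSum R + (N + 1) * ∑ a, (m a : ℝ) := by
      simp only [Finset.sum_add_distrib, Finset.sum_const, Finset.card_univ, Fintype.card_fin,
        Finset.card_range, nsmul_eq_mul, ← Finset.mul_sum, weightedLogSum]
      push_cast
      rfl
    _ ≤ _ := by
      gcongr
      linarith

lemma abs_log_tprod_holeFactor_add_le (hn : 1 ≤ n) (m : Fin n → ℕ) (hR : 1 ≤ R)
    (hRr : R ^ n = r ^ 2) :
    |log (∏' k, holeFactor m r k) + n / 4 * R ^ 2| ≤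
      (11 * n + 2 * ∑ a, (m a : ℝ)) * (R * (1 + log R)) := by
  have hR0 : 0 < R := by linarith
  have hs := summable_log_holeFactor hn m hR0 hRr
  rw [← Real.rexp_tsum_eq_tprod (holeFactor_pos hn m hR0 hRr) hs, log_exp]
  have hupper := tsum_log_holeFactor_le hn m hR hRr
  have hlower : n * (weightedLogSum R - 4 * R * (2 + log R) - 2) ≤
      ∑' k, log (holeFactor m r k) :=
    calc _ ≤ n * ∑' k, log (gammaSurvival k R) := by
          gcongr
          exact tsum_log_gammaSurvival_ge hR
      _ = ∑' k, n * log (gammaSurvival k R) := tsum_mul_left.symm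
      _ ≤ _ := Summable.tsum_le_tsum (log_holeFactor_ge hn m hR0 hRr)
        ((summable_log_gammaSurvival hR0).mul_left _) hs
  have hn0 : (0 : ℝ) ≤ n := Nat.cast_nonneg n
  have hm0 : 0 ≤ ∑ a, (m a : ℝ) := Finset.sum_nonneg fun a _ => Nat.cast_nonneg _
  have hlog := log_nonneg hR
  have hRlog : 0 ≤ R * log R := mul_nonneg hR0.le hlog
  obtain ⟨h1, h2⟩ := abs_le.1 (abs_weightedLogSum_add_le hR)
  have h1' := mul_le_mul_of_nonneg_left h1 hn0
  have h2' := mul_le_mul_of_nonneg_left h2 hn0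
  have e1 := mul_nonneg hn0 hRlog
  have e2 := mul_nonneg hm0 hRlog
  have e3 := mul_nonneg hn0 (sub_nonneg.2 hR)
  have e4 := mul_nonneg hm0 hR0.le
  rw [abs_le]
  constructor <;> nlinarith

end HoleLog

lemma tendsto_one_add_log_div : Tendsto (fun R : ℝ => (1 + log R) / R) atTop (nhds 0) := by
  have h1 := tendsto_inv_atTop_zero (𝕜 := ℝ)
  have h2 := Real.isLittleO_log_id_atTop.tendsto_div_nhds_zero
  refine (add_zero (0 : ℝ) ▸ h1.add h2).congr fun R => ?_
  simp only [id]
  ring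

/-- The leading-order decay of the hole probability of the generalised induced infinite
complex Ginibre ensemble:
`lim_{r→∞} r^{-4/n} log(∏_{k=1}^∞ p_k(r)) = -n/4`, independently of `m_1,…,m_n`. -/
theorem hole_probability_infinite_leading_order
    (n : ℕ) (hn : 1 ≤ n) (m : Fin n → ℕ)
    (p : ℕ → ℝ → ℝ)
    (hp : ∀ (k : ℕ) (r : ℝ), p k r =
      ∫ x : Fin n → ℝ in {x | (∀ a, 0 < x a) ∧ r ^ 2 < ∏ a, x a},
        ∏ a, x a ^ ((k : ℝ) + (m a : ℝ) - 1) * Real.exp (-x a) /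
          Real.Gamma ((k : ℝ) + (m a : ℝ))) :
    Tendsto (fun r : ℝ => (r ^ ((4 : ℝ) / n))⁻¹ * Real.log (∏' k : ℕ, p (k + 1) r))
      atTop (nhds (-((n : ℝ) / 4))) := by
  have hn0 : (0 : ℝ) < n := by exact_mod_cast hn
  have hfactor : ∀ r k, p (k + 1) r = holeFactor m r k := fun r k => by
    rw [hp, holeFactor]
    refine setIntegral_congr_fun (measurableSet_productExceeds r) fun x _ => ?_
    refine Finset.prod_congr rfl fun a _ => ?_
    have e1 : ((k + 1 : ℕ) : ℝ) + (m a : ℝ) - 1 = ((k + m a : ℕ) : ℝ) := by push_cast; ring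
    have e2 : ((k + 1 : ℕ) : ℝ) + (m a : ℝ) = ((k + m a : ℕ) : ℝ) + 1 := by push_cast; ring
    rw [e1, e2, Real.rpow_natCast, Real.Gamma_nat_eq_factorial, gammaDensity]
  simp only [hfactor]
  have hRtop : Tendsto (fun r : ℝ => r ^ ((2 : ℝ) / n)) atTop atTop :=
    tendsto_rpow_atTop (by positivity)
  set C : ℝ := 11 * n + 2 * ∑ a, (m a : ℝ)
  have hbound := (tendsto_one_add_log_div.const_mul C).comp hRtop
  rw [mul_zero] at hbound
  rw [tendsto_iff_norm_sub_tendsto_zero]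
  refine squeeze_zero' (Eventually.of_forall fun _ => norm_nonneg _) ?_ hbound
  filter_upwards [eventually_ge_atTop 1] with r hr
  have hr0 : 0 ≤ r := by linarith
  have hR : 1 ≤ r ^ ((2 : ℝ) / n) := one_le_rpow hr (by positivity)
  have hRr : (r ^ ((2 : ℝ) / n)) ^ n = r ^ 2 := by
    rw [← Real.rpow_mul_natCast hr0, div_mul_cancel₀ _ hn0.ne']
    exact_mod_cast Real.rpow_natCast r 2
  have hR2 : r ^ ((4 : ℝ) / n) = (r ^ ((2 : ℝ) / n)) ^ 2 := by
    rw [← Real.rpow_mul_natCast hr0]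
    congr 1
    push_cast
    ring
  have h := abs_log_tprod_holeFactor_add_le hn m hR hRr
  rw [hR2, Function.comp_apply]
  generalize r ^ ((2 : ℝ) / n) = R at *
  have hR0 : 0 < R := by linarith
  have e : (R ^ 2)⁻¹ * log (∏' k, holeFactor m r k) - -((n : ℝ) / 4) =
      (log (∏' k, holeFactor m r k) + n / 4 * R ^ 2) / R ^ 2 := by
    field_simp
    ring
  rw [e, Real.norm_eq_abs, abs_div, abs_of_pos (show 0 < R ^ 2 by positivity),
    div_le_iff₀ (by positivity)]
  refine h.trans_eq ?_
  change C * _ = _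
  field_simp
end

section
/- For every integer N ≥ 1 and all nonnegative reals r_1, …, r_N, writing z_k = r_k e^{iθ_k} and letting (x_1, …, x_{2N}) = (z_1, \bar z_1, z_2, \bar z_2, …, z_N, \bar z_N), one has ∫_{[0,2π]^N} ∏_{k=1}^N ( \bar z_k − z_k ) ∏_{1≤i<j≤2N} (x_i − x_j) dθ_1 ⋯ dθ_N = (4π)^N Σ_{σ ∈ S_N} ∏_{i=1}^N r_i^{4σ(i)−2}, i.e. the integral equals (4π)^N times the permanent of the N×N matrix with entries r_i^{4j−2}. -/
open MeasureTheory Real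

/-- The integral of a character of the circle over a full period. -/
lemma integral_Icc_exp_int_mul (n : ℤ) :
    ∫ θ in Set.Icc (0 : ℝ) (2 * π), Complex.exp (Complex.I * n * θ)
      = if n = 0 then 2 * (π : ℂ) else 0 := by
  rw [integral_Icc_eq_integral_Ioc, ← intervalIntegral.integral_of_le (by positivity)]
  split_ifs with h
  · simp [h]
  · have hc : Complex.I * n ≠ 0 := mul_ne_zero Complex.I_ne_zero (by exact_mod_cast h)
    rw [integral_exp_mul_complex hc]
    have : Complex.exp (Complex.I * n * ((2 * π : ℝ) : ℂ)) = 1 :=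
      Complex.exp_eq_one_iff.2 ⟨n, by push_cast; ring⟩
    rw [this]
    simp

/-- The antisymmetric kernel supported on pairs of consecutive integers. -/
noncomputable def consecutivePairing (r : ℝ) (a b : ℕ) : ℂ :=
  2 * π * (r : ℂ) ^ (a + b + 1) * ((if b = a + 1 then 1 else 0) - (if a = b + 1 then 1 else 0))

lemma integral_Icc_conj_sub_mul_pow (r : ℝ) (a b : ℕ) (w : ℝ → ℂ)
    (hw : ∀ θ, w θ = (r : ℂ) * Complex.exp (Complex.I * θ)) :
    ∫ θ in Set.Icc (0 : ℝ) (2 * π),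
        ((starRingEnd ℂ) (w θ) - w θ) * ((-w θ) ^ a * (-(starRingEnd ℂ) (w θ)) ^ b)
      = consecutivePairing r a b := by
  have hconj : ∀ θ, (starRingEnd ℂ) (w θ) = r * Complex.exp (-(Complex.I * θ)) := by
    intro θ
    rw [hw, map_mul, ← Complex.exp_conj]
    simp
  have hexp : ∀ θ : ℝ,
      ((starRingEnd ℂ) (w θ) - w θ) * ((-w θ) ^ a * (-(starRingEnd ℂ) (w θ)) ^ b)
        = (-1) ^ (a + b) * (r : ℂ) ^ (a + b + 1) *
          (Complex.exp (Complex.I * ((a - b - 1 : ℤ) : ℂ) * θ)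
            - Complex.exp (Complex.I * ((a - b + 1 : ℤ) : ℂ) * θ)) := by
    intro θ
    have h1 : Complex.exp (Complex.I * ((a - b - 1 : ℤ) : ℂ) * θ)
        = Complex.exp (Complex.I * θ) ^ a * Complex.exp (-(Complex.I * θ)) ^ b *
          Complex.exp (-(Complex.I * θ)) := by
      rw [← Complex.exp_nat_mul, ← Complex.exp_nat_mul, ← Complex.exp_add, ← Complex.exp_add]
      push_cast; ring_nf
    have h2 : Complex.exp (Complex.I * ((a - b + 1 : ℤ) : ℂ) * θ)
        = Complex.exp (Complex.I * θ) ^ a * Complex.exp (-(Complex.I * θ)) ^ b *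
          Complex.exp (Complex.I * θ) := by
      rw [← Complex.exp_nat_mul, ← Complex.exp_nat_mul, ← Complex.exp_add, ← Complex.exp_add]
      push_cast; ring_nf
    rw [h1, h2, hconj, hw, neg_pow (_ * _) a, neg_pow (_ * _) b, mul_pow, mul_pow]
    ring
  have hint : ∀ n : ℤ, IntegrableOn (fun θ : ℝ => Complex.exp (Complex.I * n * θ))
      (Set.Icc (0 : ℝ) (2 * π)) := fun n =>
    (by fun_prop : Continuous fun θ : ℝ => Complex.exp (Complex.I * n * θ)).integrableOn_Icc
  simp_rw [hexp]
  rw [integral_const_mul, integral_sub (hint _) (hint _), integral_Icc_exp_int_mul,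
    integral_Icc_exp_int_mul, consecutivePairing]
  by_cases h1 : b = a + 1
  · subst h1
    have e1 : ¬ ((a : ℤ) - ((a + 1 : ℕ) : ℤ) - 1 = 0) := by omega
    have e2 : (a : ℤ) - ((a + 1 : ℕ) : ℤ) + 1 = 0 := by omega
    have e3 : ¬ (a = a + 1 + 1) := by omega
    have e4 : (-1 : ℂ) ^ (a + (a + 1)) = -1 := Odd.neg_one_pow ⟨a, by ring⟩
    rw [if_neg e1, if_pos e2, if_pos rfl, if_neg e3, e4]
    ring
  · by_cases h2 : a = b + 1
    · subst h2
      have e1 : ((b + 1 : ℕ) : ℤ) - b - 1 = 0 := by omega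
      have e2 : ¬ (((b + 1 : ℕ) : ℤ) - b + 1 = 0) := by omega
      have e4 : (-1 : ℂ) ^ (b + 1 + b) = -1 := Odd.neg_one_pow ⟨b, by ring⟩
      rw [if_pos e1, if_neg e2, if_neg h1, if_pos rfl, e4]
      ring
    · have e1 : ¬ ((a : ℤ) - b - 1 = 0) := by omega
      have e2 : ¬ ((a : ℤ) - b + 1 = 0) := by omega
      rw [if_neg e1, if_neg e2, if_neg h1, if_neg h2]
      ring

/-- An involution of an initial segment of `ℕ` that moves every point by one pairs `2m` with
`2m + 1`. -/
lemma involutive_apply_two_mul {n : ℕ} (g : Fin n → Fin n) (hg : Function.Involutive g)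
    (h : ∀ i, (g i : ℕ) = i + 1 ∨ (i : ℕ) = g i + 1) (m : ℕ) (hm : 2 * m < n) :
    (g ⟨2 * m, hm⟩ : ℕ) = 2 * m + 1 := by
  induction m with
  | zero => have := h ⟨2 * 0, hm⟩; simp at this ⊢; omega
  | succ m ih =>
    have ih := ih (by omega)
    rcases h ⟨2 * (m + 1), hm⟩ with h | h
    · exact h
    · have : g ⟨2 * (m + 1), hm⟩ = g ⟨2 * m, by omega⟩ := by
        ext; simp only [] at h; omega
      have := congrArg Fin.val (hg.injective this)
      simp at this

/-- The interleaving bijection `(k, b) ↦ 2k + b`. -/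
def interleave (N : ℕ) : Fin N × Fin 2 ≃ Fin (2 * N) :=
  finProdFinEquiv.trans (finCongr (mul_comm N 2))

lemma val_interleave (N : ℕ) (p : Fin N × Fin 2) :
    (interleave N p : ℕ) = 2 * p.1 + p.2 := by
  simp [interleave, add_comm]

/-- The permutation of `Fin N × Fin 2` which permutes the blocks by `π` and acts on the `k`-th
block by `f k`. -/
def blockPerm {N : ℕ} (q : Equiv.Perm (Fin N) × (Fin N → Equiv.Perm (Fin 2))) :
    Equiv.Perm (Fin N × Fin 2) :=
  Equiv.prodCongrLeft (fun _ => q.1) * Equiv.prodCongrRight q.2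

lemma blockPerm_apply {N : ℕ} (q : Equiv.Perm (Fin N) × (Fin N → Equiv.Perm (Fin 2)))
    (k : Fin N) (b : Fin 2) : blockPerm q (k, b) = (q.1 k, q.2 k b) := rfl

lemma blockPerm_injective (N : ℕ) : Function.Injective (blockPerm (N := N)) := by
  intro q q' h
  have h' : ∀ k b, (q.1 k, q.2 k b) = (q'.1 k, q'.2 k b) := fun k b => by
    rw [← blockPerm_apply, ← blockPerm_apply, h]
  refine Prod.ext (Equiv.ext fun k => ?_) (funext fun k => Equiv.ext fun b => ?_)
  · exact congrArg Prod.fst (h' k 0)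
  · exact congrArg Prod.snd (h' k b)

lemma sign_blockPerm {N : ℕ} (q : Equiv.Perm (Fin N) × (Fin N → Equiv.Perm (Fin 2))) :
    Equiv.Perm.sign (blockPerm q) = ∏ k, Equiv.Perm.sign (q.2 k) := by
  rw [blockPerm, Equiv.Perm.sign_mul, Equiv.Perm.sign_prodCongrLeft,
    Equiv.Perm.sign_prodCongrRight]
  simp

/-- A permutation sending each block to a pair of consecutive integers is a block permutation. -/
lemma exists_blockPerm_eq {N : ℕ} (τ : Equiv.Perm (Fin N × Fin 2))
    (h : ∀ k, (interleave N (τ (k, 1)) : ℕ) = interleave N (τ (k, 0)) + 1 ∨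
      (interleave N (τ (k, 0)) : ℕ) = interleave N (τ (k, 1)) + 1) :
    ∃ q, blockPerm q = τ := by
  have hfst : ∀ k, (τ (k, 0)).1 = (τ (k, 1)).1 := by
    let s : Fin N × Fin 2 → Fin N × Fin 2 := fun p => (p.1, p.2.rev)
    let g : Fin (2 * N) → Fin (2 * N) := fun i =>
      interleave N (τ (s (τ.symm ((interleave N).symm i))))
    have hg : Function.Involutive g := fun i => by simp [g, s]
    have hstep : ∀ i, (g i : ℕ) = i + 1 ∨ (i : ℕ) = g i + 1 := by
      intro i
      obtain ⟨⟨k, b⟩, rfl⟩ := (τ.trans (interleave N)).surjective i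
      have hk := h k
      fin_cases b
      · simpa [g, s] using hk
      · simpa [g, s] using hk.symm
    have key : ∀ (k : Fin N) (b : Fin 2), (τ (k, b)).2 = 0 →
        (τ (k, b.rev)).1 = (τ (k, b)).1 := by
      intro k b hb
      have hlt : 2 * ((τ (k, b)).1 : ℕ) < 2 * N := by omega
      have hi : interleave N (τ (k, b)) = ⟨2 * ((τ (k, b)).1 : ℕ), hlt⟩ := by
        ext; simp [val_interleave, hb]
      have := involutive_apply_two_mul g hg hstep _ hlt
      rw [← hi] at this
      simp only [g, s, Equiv.symm_apply_apply, val_interleave] at this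
      ext; omega
    intro k
    by_cases h0 : (τ (k, 0)).2 = 0
    · exact (key k 0 h0).symm
    · by_cases h1 : (τ (k, 1)).2 = 0
      · exact key k 1 h1
      · have := h k
        simp only [val_interleave] at this
        ext; omega
  have hfst' : ∀ k b, (τ (k, b)).1 = (τ (k, 0)).1 := by
    intro k b
    fin_cases b
    · rfl
    · exact (hfst k).symm
  have hsnd : ∀ k, Function.Injective fun b => (τ (k, b)).2 := by
    intro k b b' hb
    have : τ (k, b) = τ (k, b') := Prod.ext ((hfst' k b).trans (hfst' k b').symm) hb
    exact congrArg Prod.snd (τ.injective this)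
  have hsurj : Function.Surjective fun k => (τ (k, 0)).1 := by
    intro m
    obtain ⟨⟨k, b⟩, hk⟩ := τ.surjective (m, 0)
    exact ⟨k, by simp only [← hfst' k b, hk]⟩
  refine ⟨(Equiv.ofBijective _ (Finite.injective_iff_bijective.1
    (Finite.injective_iff_surjective.2 hsurj)),
    fun k => Equiv.ofBijective _ (Finite.injective_iff_bijective.1 (hsnd k))), ?_⟩
  ext1 ⟨k, b⟩
  rw [blockPerm_apply]
  exact Prod.ext (hfst' k b).symm rfl

lemma sign_mul_consecutivePairing (r : ℝ) (m : ℕ) (f : Equiv.Perm (Fin 2)) :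
    ((Equiv.Perm.sign f : ℤ) : ℂ) * consecutivePairing r (2 * m + f 0) (2 * m + f 1)
      = 2 * π * (r : ℂ) ^ (4 * m + 2) := by
  have hf : f = 1 ∨ f = Equiv.swap 0 1 := by revert f; decide
  rcases hf with rfl | rfl
  · have hm : 2 * m ≠ 2 * m + 1 + 1 := by omega
    simp [consecutivePairing, hm]
    ring
  · have hm : 2 * m ≠ 2 * m + 1 + 1 := by omega
    simp [consecutivePairing, hm]
    ring

lemma sum_sign_mul_prod_consecutivePairing {N : ℕ} (r : Fin N → ℝ) :
    ∑ τ : Equiv.Perm (Fin N × Fin 2), ((Equiv.Perm.sign τ : ℤ) : ℂ) *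
        ∏ k, consecutivePairing (r k) (interleave N (τ (k, 0))) (interleave N (τ (k, 1)))
      = (4 * π) ^ N * ∑ σ : Equiv.Perm (Fin N), ∏ i, (r i : ℂ) ^ (4 * (σ i : ℕ) + 2) := by
  have hval : ∀ q : Equiv.Perm (Fin N) × (Fin N → Equiv.Perm (Fin 2)),
      ((Equiv.Perm.sign (blockPerm q) : ℤ) : ℂ) * ∏ k, consecutivePairing (r k)
        (interleave N (blockPerm q (k, 0))) (interleave N (blockPerm q (k, 1)))
      = (2 * π) ^ N * ∏ i, (r i : ℂ) ^ (4 * (q.1 i : ℕ) + 2) := by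
    intro q
    simp only [sign_blockPerm, blockPerm_apply, val_interleave]
    push_cast
    rw [← Finset.prod_mul_distrib]
    simp_rw [sign_mul_consecutivePairing]
    rw [Finset.prod_mul_distrib]
    simp
  rw [← Finset.sum_of_injOn (s := Finset.univ) blockPerm
    (blockPerm_injective N).injOn (by simp) ?_ (fun q _ => (hval q).symm)]
  · rw [Fintype.sum_prod_type]
    simp only [Finset.sum_const, Finset.card_univ, nsmul_eq_mul, Fintype.card_pi,
      Fintype.card_perm, Fintype.card_fin, Finset.prod_const, Finset.mul_sum]
    refine Finset.sum_congr rfl fun σ _ => ?_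
    rw [show (4 * π : ℂ) = 2 * (2 * π) by ring, mul_pow 2 (2 * π : ℂ)]
    push_cast [Nat.factorial]
    ring
  · intro τ _ hτ
    by_contra hne
    refine hτ ?_
    obtain ⟨q, hq⟩ := exists_blockPerm_eq τ fun k => by
      by_contra hk
      rw [not_or] at hk
      refine hne (mul_eq_zero_of_right _ (Finset.prod_eq_zero (Finset.mem_univ k) ?_))
      rw [consecutivePairing, if_neg hk.1, if_neg hk.2]
      ring
    exact ⟨q, by simp, hq⟩

/-- Expansion of the Vandermonde product in interleaved variables. -/
lemma prod_sub_eq_sum_perm {N : ℕ} (x : Fin (2 * N) → ℂ) :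
    ∏ i, ∏ j ∈ Finset.Ioi i, (x i - x j)
      = ∑ τ : Equiv.Perm (Fin N × Fin 2), ((Equiv.Perm.sign τ : ℤ) : ℂ) *
          ∏ k, ((-x (interleave N (k, 0))) ^ (interleave N (τ (k, 0)) : ℕ) *
            (-x (interleave N (k, 1))) ^ (interleave N (τ (k, 1)) : ℕ)) := by
  have h := Matrix.det_vandermonde (fun i => -x i)
  simp only [neg_sub_neg] at h
  rw [← h, ← Matrix.det_submatrix_equiv_self (interleave N), ← Matrix.det_transpose,
    Matrix.det_apply']
  simp [Fintype.prod_prod_type, Fin.prod_univ_two, Matrix.vandermonde_apply]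

/-- Quaternionic angular integral: with `z_k = r_k e^{iθ_k}` and the interleaved
variables `(x_1,…,x_{2N}) = (z_1, z̄_1, …, z_N, z̄_N)`,
`∫_{[0,2π]^N} ∏_k (z̄_k - z_k) ∏_{1≤i<j≤2N}(x_i - x_j) dθ = (4π)^N per(r_i^{4j-2})`. -/
theorem quaternion_angular_integral_eq_permanent
    (N : ℕ) (hN : 1 ≤ N) (r : Fin N → ℝ) (hr : ∀ i, 0 ≤ r i)
    (z : (Fin N → ℝ) → Fin N → ℂ)
    (hz : ∀ θ k, z θ k = (r k : ℂ) * Complex.exp (Complex.I * (θ k : ℂ)))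
    (x : (Fin N → ℝ) → Fin (2 * N) → ℂ)
    (hx : ∀ θ (i : Fin (2 * N)), x θ i =
      if (i : ℕ) % 2 = 0 then z θ ⟨(i : ℕ) / 2, by have := i.isLt; omega⟩
      else (starRingEnd ℂ) (z θ ⟨(i : ℕ) / 2, by have := i.isLt; omega⟩)) :
    (∫ θ : Fin N → ℝ in Set.univ.pi fun _ => Set.Icc (0 : ℝ) (2 * π),
        (∏ k : Fin N, ((starRingEnd ℂ) (z θ k) - z θ k)) *
          ∏ i : Fin (2 * N), ∏ j ∈ Finset.Ioi i, (x θ i - x θ j))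
      = ((((4 * π) ^ N : ℝ)) : ℂ) *
          ∑ σ : Equiv.Perm (Fin N), ∏ i : Fin N,
            ((r i : ℂ)) ^ (4 * (σ i : ℕ) + 2) := by
  have hx0 : ∀ θ k, x θ (interleave N (k, 0)) = z θ k := by
    intro θ k
    have h0 : (interleave N (k, 0) : ℕ) = 2 * k := by simp [val_interleave]
    rw [hx, if_pos (by omega)]
    congr 1; ext; simp only []; omega
  have hx1 : ∀ θ k, x θ (interleave N (k, 1)) = (starRingEnd ℂ) (z θ k) := by
    intro θ k
    have h1 : (interleave N (k, 1) : ℕ) = 2 * k + 1 := by simp [val_interleave]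
    rw [hx, if_neg (by omega)]
    congr 2; ext; simp only []; omega
  let w : Fin N → ℝ → ℂ := fun k t => (r k : ℂ) * Complex.exp (Complex.I * t)
  let F : Equiv.Perm (Fin N × Fin 2) → Fin N → ℝ → ℂ := fun τ k t =>
    ((starRingEnd ℂ) (w k t) - w k t) *
      ((-w k t) ^ (interleave N (τ (k, 0)) : ℕ) *
        (-(starRingEnd ℂ) (w k t)) ^ (interleave N (τ (k, 1)) : ℕ))
  have hF : ∀ τ k, Continuous (F τ k) := fun τ k => by
    have hw : Continuous (w k) := by fun_prop
    have hw' : Continuous fun t => (starRingEnd ℂ) (w k t) := Complex.continuous_conj.comp hw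
    exact (hw'.sub hw).mul ((hw.neg.pow _).mul (hw'.neg.pow _))
  have hexpand : ∀ θ : Fin N → ℝ,
      (∏ k : Fin N, ((starRingEnd ℂ) (z θ k) - z θ k)) *
          ∏ i : Fin (2 * N), ∏ j ∈ Finset.Ioi i, (x θ i - x θ j)
        = ∑ τ : Equiv.Perm (Fin N × Fin 2), ((Equiv.Perm.sign τ : ℤ) : ℂ) *
            ∏ k, F τ k (θ k) := by
    intro θ
    rw [prod_sub_eq_sum_perm, Finset.mul_sum]
    refine Finset.sum_congr rfl fun τ _ => ?_
    rw [mul_left_comm, ← Finset.prod_mul_distrib]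
    simp only [hx0, hx1, hz, F, w]
  simp_rw [hexpand]
  rw [integral_finsetSum]
  · simp_rw [integral_const_mul]
    push_cast
    rw [← sum_sign_mul_prod_consecutivePairing]
    refine Finset.sum_congr rfl fun τ _ => ?_
    rw [volume_pi, Measure.restrict_pi_pi, integral_fintype_prod_eq_prod]
    congr 1
    exact Finset.prod_congr rfl fun k _ =>
      integral_Icc_conj_sub_mul_pow (r k) _ _ (w k) fun _ => rfl
  · intro τ _
    refine ContinuousOn.integrableOn_compact ?_ (Continuous.continuousOn ?_)
    · exact isCompact_univ_pi fun _ => isCompact_Icc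
    · exact continuous_const.mul
        (continuous_finsetProd _ fun k _ => (hF τ k).comp (continuous_apply k))
end
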